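/- The following ℚ-linear subspaces of ℌ coincide: A1 := span{φ(u ∗ v)x : u, v ∈ yℌ}; A5 := span{∑_{i=1}^M n_i A_i (x+y)^s B_i : s, M ∈ ℤ≥0, n_i ∈ ℚ, A_i ∈ yℌ, B_i ∈ ℌx, with ∑_{i=1}^M n_i f(A_i, B_i) = 0}; and A6 := span{∑_{i=1}^M n_i A_i B_i : M ∈ ℤ≥0, n_i ∈ ℚ, A_i ∈ yℌ, B_i ∈ ℌx, with ∑_{i=1}^M n_i f(A_i, B_i) = 0}. -/

import Mathlib

open scoped BigOperators

noncomputable section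

/-- `ℌ = ℚ⟨x,y⟩`, the free noncommutative polynomial ring in two indeterminates,
realized as the free `ℚ`-algebra on `Bool` (`false ↦ x`, `true ↦ y`). -/
abbrev H : Type := FreeAlgebra ℚ Bool

/-- The indeterminate `x`. -/
def Hx : H := FreeAlgebra.ι ℚ false

/-- The indeterminate `y`. -/
def Hy : H := FreeAlgebra.ι ℚ true

/-- The multiple zeta value `ζ(k₁,…,k_r) = ∑_{0<n₁<⋯<n_r} 1/(n₁^{k₁}⋯n_r^{k_r})`. -/
def MZV (r : ℕ) (k : Fin r → ℕ) : ℝ :=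
  ∑' n : {n : Fin r → ℕ // (∀ i, 0 < n i) ∧ StrictMono n},
    ∏ i, (1 : ℝ) / (n.1 i : ℝ) ^ (k i)

/-- `Z : yℌx → ℝ` is the `ℚ`-linear map with `Z(y x^{k₁-1} ⋯ y x^{k_r-1}) = ζ(k₁,…,k_r)`.
We encode it as a `ℚ`-linear map on all of `ℌ` whose values on the basis monomials
`y x^{k₁-1} ⋯ y x^{k_r-1}` (with `k_r ≥ 2`) of `yℌx` are the multiple zeta values;
these values determine `Z` uniquely on the subspace `yℌx`. -/
def IsZetaMap (Z : H →ₗ[ℚ] ℝ) : Prop :=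
  ∀ (r : ℕ) (k : Fin (r + 1) → ℕ), (∀ i, 1 ≤ k i) → 2 ≤ k (Fin.last r) →
    Z ((List.ofFn fun i => Hy * Hx ^ (k i - 1)).prod) = MZV (r + 1) k

/-- The family `f(A,B) = (Z(A(x+y)^s B))_{s ≥ 0}`. -/
def fam (Z : H →ₗ[ℚ] ℝ) (A B : H) : ℕ → ℝ := fun s => Z (A * (Hx + Hy) ^ s * B)

/-- The `ℚ`-bilinear product `◇` on `ℌ`, characterized by its recursive defining
properties (which determine it uniquely). -/
def IsDiamond (d : H →ₗ[ℚ] H →ₗ[ℚ] H) : Prop :=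
  (∀ w, d w 1 = w) ∧ (∀ w, d 1 w = w) ∧
  (∀ w1 w2, d (Hx * w1) (Hx * w2) = Hx * d w1 (Hx * w2) - Hx * d (Hy * w1) w2) ∧
  (∀ w1 w2, d (Hx * w1) (Hy * w2) = Hx * d w1 (Hy * w2) + Hy * d (Hx * w1) w2) ∧
  (∀ w1 w2, d (Hy * w1) (Hx * w2) = Hy * d w1 (Hx * w2) + Hx * d (Hy * w1) w2) ∧
  (∀ w1 w2, d (Hy * w1) (Hy * w2) = Hy * d w1 (Hy * w2) - Hy * d (Hx * w1) w2)

/-- The harmonic product `∗` on `ℌ`, characterized by its recursive defining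
properties (which determine it uniquely). -/
def IsHarmonic (st : H →ₗ[ℚ] H →ₗ[ℚ] H) : Prop :=
  (∀ w, st w 1 = w) ∧ (∀ w, st 1 w = w) ∧
  (∀ w1 w2, st (Hx * w1) w2 = Hx * st w1 w2) ∧
  (∀ w1 w2, st w1 (Hx * w2) = Hx * st w1 w2) ∧
  (∀ w1 w2, st (Hy * w1) (Hy * w2) = Hy * (st w1 (Hy * w2) + st (Hy * w1) w2 + Hx * st w1 w2))

/-- The anti-automorphism `τ` of `ℌ` interchanging `x` and `y`, characterized by
being `ℚ`-linear, anti-multiplicative, unital, and swapping the generators. -/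
def IsTau (t : H →ₗ[ℚ] H) : Prop :=
  t 1 = 1 ∧ (∀ a b, t (a * b) = t b * t a) ∧ t Hx = Hy ∧ t Hy = Hx

/-- The automorphism `φ` of `ℌ` with `φ(x) = x + y` and `φ(y) = -y`. -/
def phi : H →ₐ[ℚ] H := FreeAlgebra.lift ℚ (fun b => if b then -Hy else Hx + Hy)

/-- The automorphism `S₁` of `ℌ` with `S₁(x) = x` and `S₁(y) = x + y`. -/
def S1 : H →ₐ[ℚ] H := FreeAlgebra.lift ℚ (fun b => if b then Hx + Hy else Hx)

/-- The Dirichlet series `∑_{n ≥ 1} a_n / n^s` (with `a n` the coefficient indexed by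
`n + 1`) converges to `L` at `s`, i.e. its partial sums tend to `L`. -/
def DSConv (a : ℕ → ℝ) (s : ℕ) (L : ℝ) : Prop :=
  Filter.Tendsto (fun N => ∑ n ∈ Finset.range N, a n / ((n : ℝ) + 1) ^ s)
    Filter.atTop (nhds L)


/-! ### Induction principles on `H` -/

theorem Hind_right {C : H → Prop} (h1 : C 1) (hadd : ∀ a b, C a → C b → C (a + b))
    (hsmul : ∀ (r : ℚ) a, C a → C (r • a)) (hx : ∀ a, C a → C (a * Hx))
    (hy : ∀ a, C a → C (a * Hy)) (a : H) : C a := by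
  have key : ∀ a : H, ∀ b, C b → C (b * a) := by
    intro a
    induction a using FreeAlgebra.induction with
    | grade0 r =>
      intro b hb
      have : b * algebraMap ℚ H r = r • b := by
        rw [← Algebra.commutes, Algebra.smul_def]
      rw [this]; exact hsmul r b hb
    | grade1 x =>
      intro b hb
      cases x
      · exact hx b hb
      · exact hy b hb
    | mul a₁ a₂ h₁ h₂ =>
      intro b hb
      rw [← mul_assoc]
      exact h₂ _ (h₁ _ hb)
    | add a₁ a₂ h₁ h₂ =>
      intro b hb
      rw [mul_add]
      exact hadd _ _ (h₁ _ hb) (h₂ _ hb)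
  simpa using key a 1 h1

theorem Hind_left {C : H → Prop} (h1 : C 1) (hadd : ∀ a b, C a → C b → C (a + b))
    (hsmul : ∀ (r : ℚ) a, C a → C (r • a)) (hx : ∀ a, C a → C (Hx * a))
    (hy : ∀ a, C a → C (Hy * a)) (a : H) : C a := by
  have key : ∀ a : H, ∀ b, C b → C (a * b) := by
    intro a
    induction a using FreeAlgebra.induction with
    | grade0 r =>
      intro b hb
      rw [← Algebra.smul_def]; exact hsmul r b hb
    | grade1 x =>
      intro b hb
      cases x
      · exact hx b hb
      · exact hy b hb
    | mul a₁ a₂ h₁ h₂ =>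
      intro b hb
      rw [mul_assoc]
      exact h₁ _ (h₂ _ hb)
    | add a₁ a₂ h₁ h₂ =>
      intro b hb
      rw [add_mul]
      exact hadd _ _ (h₁ _ hb) (h₂ _ hb)
  simpa using key a 1 h1

/-- Membership in `yℌ`. -/
def InY (w : H) : Prop := ∃ p, w = Hy * p

theorem InY.mul {w : H} (h : InY w) (a : H) : InY (w * a) := by
  obtain ⟨p, rfl⟩ := h
  exact ⟨p * a, by rw [mul_assoc]⟩

theorem InY.add {w v : H} (h : InY w) (h' : InY v) : InY (w + v) := by
  obtain ⟨p, rfl⟩ := h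
  obtain ⟨q, rfl⟩ := h'
  exact ⟨p + q, by rw [mul_add]⟩

theorem InY.smul {w : H} (h : InY w) (r : ℚ) : InY (r • w) := by
  obtain ⟨p, rfl⟩ := h
  exact ⟨r • p, by rw [mul_smul_comm]⟩

theorem InY.neg {w : H} (h : InY w) : InY (-w) := by
  obtain ⟨p, rfl⟩ := h
  exact ⟨-p, by rw [mul_neg]⟩

theorem InY.y : InY Hy := ⟨1, by rw [mul_one]⟩

theorem Hind_Y {C : H → Prop} (h1 : C Hy) (hadd : ∀ a b, C a → C b → C (a + b))
    (hsmul : ∀ (r : ℚ) a, C a → C (r • a)) (hx : ∀ a, InY a → C a → C (a * Hx))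
    (hy : ∀ a, InY a → C a → C (a * Hy)) {a : H} (ha : InY a) : C a := by
  obtain ⟨p, rfl⟩ := ha
  refine Hind_right (C := fun p => C (Hy * p)) ?_ ?_ ?_ ?_ ?_ p
  · simpa using h1
  · intro a b ha hb; rw [mul_add]; exact hadd _ _ ha hb
  · intro r a ha; rw [mul_smul_comm]; exact hsmul _ _ ha
  · intro a ha; rw [← mul_assoc]; exact hx _ ⟨a, rfl⟩ ha
  · intro a ha; rw [← mul_assoc]; exact hy _ ⟨a, rfl⟩ ha

/-! ### Coefficients of multiple polylogarithms -/

/-- Right multiplication by `x` on coefficient sequences. -/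
def opX : (ℕ → ℝ) →ₗ[ℚ] (ℕ → ℝ) where
  toFun c := fun n => c n / n
  map_add' c d := by ext n; simp [add_div]
  map_smul' r c := by ext n; simp [Rat.smul_def, mul_div_assoc]

/-- Right multiplication by `y` on coefficient sequences. -/
def opY : (ℕ → ℝ) →ₗ[ℚ] (ℕ → ℝ) where
  toFun c := fun n => (∑ m ∈ Finset.range n, c m) / n
  map_add' c d := by ext n; simp [Finset.sum_add_distrib, add_div]
  map_smul' r c := by ext n; simp [Rat.smul_def, ← Finset.mul_sum, mul_div_assoc]

def act : H →ₐ[ℚ] (Module.End ℚ (ℕ → ℝ))ᵐᵒᵖ :=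
  FreeAlgebra.lift ℚ (fun b => MulOpposite.op (if b then opY else opX))

/-- `coef w n` is the `n`-th coefficient of the multiple polylogarithm of `w`. -/
def coef : H →ₗ[ℚ] (ℕ → ℝ) where
  toFun w := (act w).unop (Pi.single 0 1)
  map_add' a b := by simp
  map_smul' r a := by simp

theorem coef_one : coef 1 = Pi.single 0 1 := by simp [coef]

theorem coef_mul_x (w : H) : coef (w * Hx) = opX (coef w) := by
  simp [coef, act, Hx]

theorem coef_mul_y (w : H) : coef (w * Hy) = opY (coef w) := by
  simp [coef, act, Hy]

theorem phi_x : phi Hx = Hx + Hy := by simp [phi, Hx]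

theorem phi_y : phi Hy = -Hy := by simp [phi, Hy]

theorem phi_phi (w : H) : phi (phi w) = w := by
  have : phi.comp phi = AlgHom.id ℚ H := by
    apply FreeAlgebra.hom_ext
    funext b
    cases b
    · change phi (phi Hx) = Hx
      rw [phi_x, map_add, phi_x, phi_y]; abel
    · change phi (phi Hy) = Hy
      rw [phi_y, map_neg, phi_y]; abel
  exact DFunLike.congr_fun this w

theorem InY.phi {w : H} (h : InY w) : InY (phi w) := by
  obtain ⟨p, rfl⟩ := h
  exact ⟨-(_root_.phi p), by rw [map_mul, phi_y]; simp⟩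

theorem coef_zero_of_InY {w : H} (h : InY w) : coef w 0 = 0 := by
  refine Hind_Y (C := fun w => coef w 0 = 0) ?_ ?_ ?_ ?_ ?_ h
  · rw [← one_mul Hy, coef_mul_y]; simp [opY]
  · intro a b ha hb; simp [ha, hb]
  · intro r a ha; simp [ha]
  · intro a _ _; rw [coef_mul_x]; simp [opX]
  · intro a _ _; rw [coef_mul_y]; simp [opY]

theorem coef_y (n : ℕ) : coef Hy (n + 1) = 1 / ((n : ℝ) + 1) := by
  rw [← one_mul Hy, coef_mul_y, coef_one]
  simp [opY, Pi.single_apply]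

/-! ### Growth classes -/

/-- `h N = O((N+1)^(σ+δ))` for every `0 < δ < 1`. -/
def Ob (σ : ℝ) (h : ℕ → ℝ) : Prop :=
  ∀ δ : ℝ, 0 < δ → δ < 1 → ∃ C : ℝ, 0 ≤ C ∧ ∀ N : ℕ, |h N| ≤ C * ((N : ℝ) + 1) ^ (σ + δ)

theorem n1pos (N : ℕ) : (0 : ℝ) < (N : ℝ) + 1 := by positivity

theorem Ob.congr {σ : ℝ} {h k : ℕ → ℝ} (hh : Ob σ h) (e : ∀ N, k N = h N) : Ob σ k := by
  have : k = h := funext e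
  rw [this]; exact hh

theorem Ob.zero (σ : ℝ) : Ob σ (fun _ => 0) := by
  intro δ _ _
  exact ⟨0, le_rfl, by simp⟩

theorem Ob.add {σ : ℝ} {h k : ℕ → ℝ} (hh : Ob σ h) (hk : Ob σ k) :
    Ob σ (fun N => h N + k N) := by
  intro δ h0 h1
  obtain ⟨C, hC, hC'⟩ := hh δ h0 h1
  obtain ⟨D, hD, hD'⟩ := hk δ h0 h1
  refine ⟨C + D, by positivity, fun N => ?_⟩
  have := abs_add_le (h N) (k N)
  have h1 := hC' N
  have h2 := hD' N
  nlinarith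

theorem Ob.mul {σ τ : ℝ} {h k : ℕ → ℝ} (hh : Ob σ h) (hk : Ob τ k) :
    Ob (σ + τ) (fun N => h N * k N) := by
  intro δ h0 h1
  obtain ⟨C, hC, hC'⟩ := hh (δ / 2) (by linarith) (by linarith)
  obtain ⟨D, hD, hD'⟩ := hk (δ / 2) (by linarith) (by linarith)
  refine ⟨C * D, by positivity, fun N => ?_⟩
  rw [abs_mul]
  have e : ((N : ℝ) + 1) ^ (σ + τ + δ) = ((N : ℝ) + 1) ^ (σ + δ / 2) * ((N : ℝ) + 1) ^ (τ + δ / 2) := by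
    rw [← Real.rpow_add (n1pos N)]; congr 1; ring
  rw [e]
  calc |h N| * |k N| ≤ (C * ((N : ℝ) + 1) ^ (σ + δ / 2)) * (D * ((N : ℝ) + 1) ^ (τ + δ / 2)) :=
        mul_le_mul (hC' N) (hD' N) (abs_nonneg _) (by positivity)
    _ = _ := by ring

theorem Ob.mono {σ τ : ℝ} {h : ℕ → ℝ} (hh : Ob σ h) (hs : σ ≤ τ) : Ob τ h := by
  intro δ h0 h1
  obtain ⟨C, hC, hC'⟩ := hh δ h0 h1
  refine ⟨C, hC, fun N => (hC' N).trans ?_⟩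
  gcongr
  · have : (0 : ℝ) ≤ N := by positivity
    linarith

theorem Ob.const (c : ℝ) : Ob 0 (fun _ => c) := by
  intro δ h0 h1
  refine ⟨|c|, by positivity, fun N => ?_⟩
  have : (1 : ℝ) ≤ ((N : ℝ) + 1) ^ (0 + δ) := by
    apply Real.one_le_rpow
    · have : (0 : ℝ) ≤ N := by positivity
      linarith
    · linarith
  nlinarith [abs_nonneg c]

theorem Ob.smul {σ : ℝ} {h : ℕ → ℝ} (hh : Ob σ h) (c : ℝ) : Ob σ (fun N => c * h N) := by
  have := (Ob.const c).mul hh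
  simpa using this

theorem Ob.neg {σ : ℝ} {h : ℕ → ℝ} (hh : Ob σ h) : Ob σ (fun N => - h N) :=
  (hh.smul (-1)).congr (fun N => by ring)

theorem Ob.sub {σ : ℝ} {h k : ℕ → ℝ} (hh : Ob σ h) (hk : Ob σ k) :
    Ob σ (fun N => h N - k N) :=
  (hh.add hk.neg).congr (fun N => by ring)

theorem Ob.inv : Ob (-1) (fun N => 1 / ((N : ℝ) + 1)) := by
  intro δ h0 h1
  refine ⟨1, by positivity, fun N => ?_⟩
  rw [abs_of_pos (by positivity), one_mul]
  change 1 / ((N : ℝ) + 1) ≤ _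
  rw [one_div, ← Real.rpow_neg_one]
  apply Real.rpow_le_rpow_of_exponent_le
  · have : (0 : ℝ) ≤ N := by positivity
    linarith
  · linarith

theorem Ob.div {σ : ℝ} {h : ℕ → ℝ} (hh : Ob σ h) : Ob (σ - 1) (fun N => h N / ((N : ℝ) + 1)) :=
  (hh.mul Ob.inv).congr (fun N => by ring)

theorem Ob.div2 {σ : ℝ} {h : ℕ → ℝ} (hh : Ob σ h) :
    Ob (σ - 2) (fun N => h N / ((N : ℝ) + 1) ^ 2) := by
  have := hh.div.div
  rw [show σ - 1 - 1 = σ - 2 by ring] at this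
  exact this.congr (fun N => by field_simp)

theorem Ob.abs {σ : ℝ} {h : ℕ → ℝ} (hh : Ob σ h) : Ob σ (fun N => |h N|) := by
  intro δ h0 h1
  obtain ⟨C, hC, hC'⟩ := hh δ h0 h1
  exact ⟨C, hC, fun N => by rw [abs_abs]; exact hC' N⟩

theorem Ob.of_le {σ : ℝ} {h k : ℕ → ℝ} (hh : Ob σ h) (e : ∀ N, |k N| ≤ |h N|) : Ob σ k := by
  intro δ h0 h1
  obtain ⟨C, hC, hC'⟩ := hh δ h0 h1
  exact ⟨C, hC, fun N => (e N).trans (hC' N)⟩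

theorem Ob.shift {σ : ℝ} (hs : σ ≤ -1) {h : ℕ → ℝ} (hh : Ob σ h) : Ob σ (fun N => h (N + 1)) := by
  intro δ h0 h1
  obtain ⟨C, hC, hC'⟩ := hh δ h0 h1
  refine ⟨C, hC, fun N => (hC' _).trans ?_⟩
  apply mul_le_mul_of_nonneg_left _ hC
  apply Real.rpow_le_rpow_of_nonpos (n1pos N)
  · push_cast; linarith
  · linarith

theorem summable_n1 {s : ℝ} (hs : s < -1) : Summable (fun N : ℕ => ((N : ℝ) + 1) ^ s) := by
  have := (summable_nat_add_iff (f := fun N : ℕ => (N : ℝ) ^ s) 1).2 (Real.summable_nat_rpow.2 hs)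
  simpa using this

theorem Ob.summable {h : ℕ → ℝ} (hh : Ob (-2) h) : Summable h := by
  obtain ⟨C, hC, hC'⟩ := hh (1 / 2) (by norm_num) (by norm_num)
  refine Summable.of_norm_bounded (g := fun N : ℕ => C * ((N : ℝ) + 1) ^ ((-2 : ℝ) + 1 / 2)) ?_ hC'
  exact (summable_n1 (by norm_num)).mul_left C

theorem Ob.tendsto {h : ℕ → ℝ} (hh : Ob (-1) h) : Filter.Tendsto h Filter.atTop (nhds 0) := by
  obtain ⟨C, hC, hC'⟩ := hh (1 / 2) (by norm_num) (by norm_num)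
  refine squeeze_zero_norm hC' ?_
  have h1 : Filter.Tendsto (fun N : ℕ => ((N : ℝ) + 1)) Filter.atTop Filter.atTop :=
    Filter.tendsto_atTop_add_const_right _ _ tendsto_natCast_atTop_atTop
  have h2 := (tendsto_rpow_neg_atTop (y := 1 / 2) (by norm_num)).comp h1
  have h3 := h2.const_mul C
  rw [mul_zero] at h3
  refine h3.congr (fun N => ?_)
  simp only [Function.comp]
  norm_num

/-- Partial sums `∑_{M ≤ N}`. -/
theorem Ob.psum {h : ℕ → ℝ} (hh : Ob (-1) h) :
    Ob 0 (fun N => ∑ M ∈ Finset.range (N + 1), h M) := by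
  intro δ h0 h1
  obtain ⟨C, hC, hC'⟩ := hh (δ / 2) (by linarith) (by linarith)
  have hs := summable_n1 (s := -1 - δ / 2) (by linarith)
  refine ⟨C * ∑' N : ℕ, ((N : ℝ) + 1) ^ (-1 - δ / 2), by positivity, fun N => ?_⟩
  calc |∑ M ∈ Finset.range (N + 1), h M| ≤ ∑ M ∈ Finset.range (N + 1), |h M| :=
        Finset.abs_sum_le_sum_abs _ _
    _ ≤ ∑ M ∈ Finset.range (N + 1),
          (C * ((N : ℝ) + 1) ^ (0 + δ)) * ((M : ℝ) + 1) ^ (-1 - δ / 2) := by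
        apply Finset.sum_le_sum
        intro M hM
        have hM' : (M : ℝ) + 1 ≤ (N : ℝ) + 1 := by
          have : M ≤ N := by simpa [Nat.lt_succ_iff] using hM
          have : (M : ℝ) ≤ N := by exact_mod_cast this
          linarith
        refine (hC' M).trans ?_
        have e : ((M : ℝ) + 1) ^ (-1 + δ / 2) = ((M : ℝ) + 1) ^ (0 + δ) * ((M : ℝ) + 1) ^ (-1 - δ / 2) := by
          rw [← Real.rpow_add (n1pos M)]; congr 1; ring
        rw [e, ← mul_assoc]
        gcongr
    _ = (C * ((N : ℝ) + 1) ^ (0 + δ)) * ∑ M ∈ Finset.range (N + 1), ((M : ℝ) + 1) ^ (-1 - δ / 2) := by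
        rw [Finset.mul_sum]
    _ ≤ (C * ((N : ℝ) + 1) ^ (0 + δ)) * ∑' M : ℕ, ((M : ℝ) + 1) ^ (-1 - δ / 2) := by
        gcongr
        exact hs.sum_le_tsum _ (fun i _ => by positivity)
    _ = _ := by ring

theorem Ob.psum' {h : ℕ → ℝ} (hh : Ob (-1) h) :
    Ob 0 (fun N => ∑ M ∈ Finset.range N, h M) := by
  have h1 := hh.psum.sub (hh.mono (show (-1 : ℝ) ≤ 0 by norm_num))
  exact h1.congr (fun N => by rw [Finset.sum_range_succ]; ring)

/-- Tails `∑_{M ≥ N}`. -/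
def tail (h : ℕ → ℝ) (N : ℕ) : ℝ := ∑' M, if N ≤ M then h M else 0

theorem Ob.tail_aux {h : ℕ → ℝ} (hh : Summable h) (N : ℕ) :
    Summable (fun M => if N ≤ M then h M else 0) := by
  refine Summable.of_norm_bounded (g := fun M => |h M|) hh.abs (fun M => ?_)
  split_ifs <;> simp

theorem Ob.tail {h : ℕ → ℝ} (hh : Ob (-2) h) : Ob (-1) (tail h) := by
  intro δ h0 h1
  obtain ⟨C, hC, hC'⟩ := hh (δ / 2) (by linarith) (by linarith)
  have hs := summable_n1 (s := -1 - δ / 2) (by linarith)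
  refine ⟨C * ∑' N : ℕ, ((N : ℝ) + 1) ^ (-1 - δ / 2), by positivity, fun N => ?_⟩
  have hb : ∀ M, ‖(if N ≤ M then h M else 0)‖ ≤
      (C * ((N : ℝ) + 1) ^ (-1 + δ)) * ((M : ℝ) + 1) ^ (-1 - δ / 2) := by
    intro M
    split_ifs with hM
    · refine (hC' M).trans ?_
      have e : ((M : ℝ) + 1) ^ (-2 + δ / 2) = ((M : ℝ) + 1) ^ (-1 + δ) * ((M : ℝ) + 1) ^ (-1 - δ / 2) := by
        rw [← Real.rpow_add (n1pos M)]; congr 1; ring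
      rw [e, ← mul_assoc]
      apply mul_le_mul_of_nonneg_right _ (by positivity)
      apply mul_le_mul_of_nonneg_left _ hC
      apply Real.rpow_le_rpow_of_nonpos (n1pos N)
      · have : (N : ℝ) ≤ M := by exact_mod_cast hM
        linarith
      · linarith
    · simp; positivity
  have := tsum_of_norm_bounded (hs.mul_left (C * ((N : ℝ) + 1) ^ (-1 + δ))).hasSum hb
  rw [tsum_mul_left] at this
  calc _ ≤ _ := this
    _ = _ := by ring

theorem tail_succ {h : ℕ → ℝ} (hh : Summable h) (N : ℕ) :
    tail h N = h N + tail h (N + 1) := by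
  have h1 : HasSum (fun M => if M = N then h N else 0) (h N) := hasSum_ite_eq N (h N)
  have h2 := h1.add (Ob.tail_aux hh (N + 1)).hasSum
  rw [tail, tail, ← h2.tsum_eq]
  congr 1; ext M
  rcases lt_trichotomy M N with h | h | h
  · rw [if_neg (by omega), if_neg (by omega), if_neg (by omega)]; simp
  · subst h; simp
  · rw [if_pos (by omega), if_neg (by omega), if_pos (by omega)]; simp

/-- Interchange of summations. -/
theorem fubini {α β : ℕ → ℝ} (ha : Ob (-1) α) (hb : Ob (-2) β) :
    ∑' N, α N * tail β N = ∑' M, β M * ∑ N ∈ Finset.range (M + 1), α N := by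
  have hsum : ∀ γ : ℕ → ℝ, ∀ M, (∑' N, if N ≤ M then γ N else 0) = ∑ N ∈ Finset.range (M + 1), γ N := by
    intro γ M
    rw [tsum_eq_sum (s := Finset.range (M + 1))]
    · apply Finset.sum_congr rfl
      intro N hN
      rw [if_pos (by simpa [Nat.lt_succ_iff] using hN)]
    · intro N hN
      rw [if_neg (by simpa [Nat.lt_succ_iff] using hN)]
  have hS : Summable (Function.uncurry fun M N : ℕ => if N ≤ M then β M * α N else 0) := by
    rw [← summable_abs_iff]
    rw [summable_prod_of_nonneg (fun _ => abs_nonneg _)]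
    have e : ∀ M N : ℕ, |Function.uncurry (fun M N : ℕ => if N ≤ M then β M * α N else 0) (M, N)|
        = if N ≤ M then |β M| * |α N| else 0 := by
      intro M N
      simp only [Function.uncurry]
      split_ifs <;> simp [abs_mul]
    constructor
    · intro M
      simp only [e]
      apply summable_of_ne_finset_zero (s := Finset.range (M + 1))
      intro N hN
      rw [if_neg (by simpa [Nat.lt_succ_iff] using hN)]
    · simp only [e]
      simp only [hsum (fun N => |β _| * |α N|)]
      simp only [← Finset.mul_sum]
      apply Ob.summable
      have := hb.abs.mul ha.abs.psum
      simpa using this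
  have := hS.tsum_comm
  calc ∑' N, α N * tail β N = ∑' N, ∑' M, (if N ≤ M then β M * α N else 0) := by
        congr 1; ext N
        rw [tail, ← tsum_mul_left]
        congr 1; ext M
        split_ifs <;> ring
    _ = ∑' M, ∑' N, (if N ≤ M then β M * α N else 0) := this
    _ = _ := by
        congr 1; ext M
        rw [hsum (fun N => β M * α N), Finset.mul_sum]

/-! ### Iterated differences -/

/-- Iterated differences `∇^N c`, with `∇ c i = c i - c (i+1)`. -/
def nb : ℕ → (ℕ → ℝ) → ℕ → ℝ
  | 0, c => c
  | N + 1, c => fun i => nb N c i - nb N c (i + 1)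

theorem nb_succ (N : ℕ) (c : ℕ → ℝ) (i : ℕ) : nb (N + 1) c i = nb N c i - nb N c (i + 1) := rfl

theorem nb_add (N : ℕ) (c d : ℕ → ℝ) : nb N (fun i => c i + d i) = fun i => nb N c i + nb N d i := by
  induction N with
  | zero => rfl
  | succ N ih => ext i; simp only [nb_succ, ih]; ring

theorem nb_smul (N : ℕ) (r : ℝ) (c : ℕ → ℝ) : nb N (fun i => r * c i) = fun i => r * nb N c i := by
  induction N with
  | zero => rfl
  | succ N ih => ext i; simp only [nb_succ, ih]; ring

theorem nb_neg (N : ℕ) (c : ℕ → ℝ) : nb N (fun i => - c i) = fun i => - nb N c i := by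
  induction N with
  | zero => rfl
  | succ N ih => ext i; simp only [nb_succ, ih]; ring

theorem nb_shift (N : ℕ) (c : ℕ → ℝ) : nb N (fun i => c (i + 1)) = fun i => nb N c (i + 1) := by
  induction N with
  | zero => rfl
  | succ N ih => ext i; simp only [nb_succ, ih]

theorem nb_congr (N : ℕ) {c d : ℕ → ℝ} (h : ∀ i, c (i + 1) = d (i + 1)) (i : ℕ) :
    nb N c (i + 1) = nb N d (i + 1) := by
  induction N generalizing i with
  | zero => exact h i
  | succ N ih => simp only [nb_succ, ih]

theorem nb_succ' (N : ℕ) (c : ℕ → ℝ) : nb (N + 1) c = nb N (fun i => c i - c (i + 1)) := by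
  induction N with
  | zero => rfl
  | succ N ih =>
    ext i
    rw [nb_succ, ih]; rfl

theorem nb_leibniz (N : ℕ) (d : ℕ → ℝ) (i : ℕ) :
    nb (N + 1) (fun j => (j : ℝ) * d j) i = i * nb (N + 1) d i - (N + 1) * nb N d (i + 1) := by
  induction N generalizing i with
  | zero => simp [nb]; ring
  | succ N ih =>
    rw [nb_succ, ih, ih, nb_succ (N + 1) d i, nb_succ N d (i + 1)]
    push_cast; ring

theorem nb_Ob {c : ℕ → ℝ} (h : Ob (-1) c) (N : ℕ) : Ob (-1) (nb N c) := by
  induction N with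
  | zero => exact h
  | succ N ih => exact ih.sub (ih.shift le_rfl)

theorem nb_Ob2 {c : ℕ → ℝ} (h : Ob (-1) c) (N k : ℕ) :
    Ob (-2) (fun i => nb N c (i + (k + 1)) / ((i : ℝ) + 1)) := by
  have h1 : Ob (-1) (fun i => nb N c (i + (k + 1))) := by
    induction k with
    | zero => exact (nb_Ob h N).shift le_rfl
    | succ k ih => exact (ih.shift le_rfl).congr (fun i => by congr 1; ring)
  have := h1.div
  norm_num at this
  exact this

theorem nb_rec {d e : ℕ → ℝ} (h : ∀ j : ℕ, ((j : ℝ) + 1) * d (j + 1) - j * d j = e j) (N j : ℕ) :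
    (j : ℝ) * nb (N + 1) d j = (N + 1) * nb N d (j + 1) - nb N e j := by
  have h1 := nb_leibniz N d j
  rw [nb_succ'] at h1
  have h2 : (fun i : ℕ => (i : ℝ) * d i - ((i + 1 : ℕ) : ℝ) * d (i + 1)) = fun i => - e i := by
    ext i; rw [← h i]; push_cast; ring
  rw [h2, nb_neg] at h1
  simp only at h1
  linarith

theorem nb_rec_zero {d e : ℕ → ℝ} (h : ∀ j : ℕ, ((j : ℝ) + 1) * d (j + 1) - j * d j = e j) (N : ℕ) :
    nb N d 1 = nb N e 0 / (N + 1) := by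
  have := nb_rec h N 0
  rw [eq_div_iff (n1pos N).ne']
  simp at this
  linarith

theorem nb_rec_sum {d e : ℕ → ℝ} (hd : Ob (-1) d) (he : Ob (-1) e)
    (h : ∀ j : ℕ, ((j : ℝ) + 1) * d (j + 1) - j * d j = e j) (N : ℕ) :
    ((N : ℝ) + 1) * ∑' i : ℕ, nb N d (i + 2) / ((i : ℝ) + 1) =
      nb N d 1 + ∑' i : ℕ, nb N e (i + 1) / ((i : ℝ) + 1) := by
  have s1 : Summable (fun i : ℕ => nb N d (i + 2) / ((i : ℝ) + 1)) := (nb_Ob2 hd N 1).summable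
  have s2 : Summable (fun i : ℕ => nb N e (i + 1) / ((i : ℝ) + 1)) := (nb_Ob2 he N 0).summable
  have e1 : ∀ i : ℕ, nb (N + 1) d (i + 1) =
      ((N : ℝ) + 1) * (nb N d (i + 2) / ((i : ℝ) + 1)) - nb N e (i + 1) / ((i : ℝ) + 1) := by
    intro i
    have := nb_rec h N (i + 1)
    have hp := n1pos i
    push_cast at this
    field_simp
    rw [mul_comm]
    linarith
  have s3 : HasSum (fun i => nb (N + 1) d (i + 1)) (((N : ℝ) + 1) * ∑' i : ℕ, nb N d (i + 2) / ((i : ℝ) + 1)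
      - ∑' i : ℕ, nb N e (i + 1) / ((i : ℝ) + 1)) := by
    have := (s1.hasSum.mul_left ((N : ℝ) + 1)).sub s2.hasSum
    exact this.congr_fun e1
  have l1 := s3.tendsto_sum_nat
  have l2 : Filter.Tendsto (fun n => ∑ i ∈ Finset.range n, nb (N + 1) d (i + 1)) Filter.atTop
      (nhds (nb N d 1)) := by
    have e2 : ∀ n, ∑ i ∈ Finset.range n, nb (N + 1) d (i + 1) = nb N d 1 - nb N d (n + 1) := by
      intro n
      induction n with
      | zero => simp
      | succ n ih => rw [Finset.sum_range_succ, ih, nb_succ]; ring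
    simp only [e2]
    have := ((nb_Ob hd N).shift le_rfl).tendsto
    simpa using this.const_sub (nb N d 1)
  have := tendsto_nhds_unique l1 l2
  linarith

/-! ### The sequences attached to an element of `H` -/

theorem Ob_coef (w : H) : Ob (-1) (coef w) := by
  refine Hind_right (C := fun w => Ob (-1) (coef w)) ?_ ?_ ?_ ?_ ?_ w
  · refine Ob.inv.of_le (fun N => ?_)
    rw [coef_one]
    cases N with
    | zero => simp
    | succ N => simp
  · intro a b ha hb; rw [map_add]; exact ha.add hb
  · intro r a ha
    refine (ha.smul r).congr (fun N => ?_)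
    simp [Rat.smul_def]
  · intro a ha
    refine ha.of_le (fun N => ?_)
    rw [coef_mul_x]
    simp only [opX, LinearMap.coe_mk, AddHom.coe_mk, abs_div, Nat.abs_cast]
    rcases Nat.eq_zero_or_pos N with h | h
    · subst h; simp
    · apply div_le_self (abs_nonneg _)
      exact_mod_cast h
  · intro a ha
    have h1 := (ha.psum'.div).smul 2
    norm_num at h1
    refine h1.of_le (fun N => ?_)
    rw [coef_mul_y]
    simp only [opY, LinearMap.coe_mk, AddHom.coe_mk, abs_div, Nat.abs_cast, abs_mul]
    rcases Nat.eq_zero_or_pos N with h | h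
    · subst h; simp
    · have h' : (1 : ℝ) ≤ N := by exact_mod_cast h
      rw [abs_of_pos (n1pos N), abs_of_pos (by norm_num : (0 : ℝ) < 2), div_le_iff₀ (by linarith)]
      have e : 2 * (|∑ M ∈ Finset.range N, coef a M| / ((N : ℝ) + 1)) * N =
        |∑ M ∈ Finset.range N, coef a M| * (2 * N / ((N : ℝ) + 1)) := by ring
      rw [e]
      apply le_mul_of_one_le_right (abs_nonneg _)
      rw [le_div_iff₀ (n1pos N)]
      linarith

def cc (w : H) : ℕ → ℝ := coef (phi w)

theorem Ob_cc (w : H) : Ob (-1) (cc w) := Ob_coef _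

theorem cc_add (v w : H) : cc (v + w) = fun i => cc v i + cc w i := by
  simp only [cc, map_add]; rfl

theorem cc_smul (r : ℚ) (w : H) : cc (r • w) = fun i => (r : ℝ) * cc w i := by
  ext i; simp [cc, Rat.smul_def]

theorem cc_one : cc 1 = Pi.single 0 1 := by simp [cc, coef_one]

theorem cc_mul_x (w : H) (j : ℕ) :
    cc (w * Hx) j = (∑ m ∈ Finset.range (j + 1), cc w m) / j := by
  rw [cc, map_mul, phi_x, mul_add, map_add, coef_mul_x, coef_mul_y, Finset.sum_range_succ]
  simp [opX, opY, cc]; ring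

theorem cc_mul_y (w : H) (j : ℕ) :
    cc (w * Hy) j = - (∑ m ∈ Finset.range j, cc w m) / j := by
  rw [cc, map_mul, phi_y, mul_neg, map_neg, coef_mul_y]
  simp [opY, cc]; ring

theorem cc_mul_xy (w : H) (j : ℕ) : cc (w * (Hx + Hy)) j = cc w j / j := by
  rw [cc, map_mul, map_add, phi_x, phi_y, add_neg_cancel_right, coef_mul_x]
  rfl

theorem cc_zero_of_InY {w : H} (h : InY w) : cc w 0 = 0 := coef_zero_of_InY h.phi

theorem rec_x {w : H} (h : cc w 0 = 0) (j : ℕ) :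
    ((j : ℝ) + 1) * cc (w * Hx) (j + 1) - j * cc (w * Hx) j = cc w (j + 1) := by
  rw [cc_mul_x, cc_mul_x]
  have h1 : (j : ℝ) * ((∑ m ∈ Finset.range (j + 1), cc w m) / j) = ∑ m ∈ Finset.range (j + 1), cc w m := by
    rcases Nat.eq_zero_or_pos j with hj | hj
    · subst hj; simp [h]
    · have : (j : ℝ) ≠ 0 := by positivity
      field_simp
  rw [h1, Finset.sum_range_succ _ (j + 1)]
  have := n1pos j
  push_cast
  field_simp
  ring

theorem rec_y (w : H) (j : ℕ) :
    ((j : ℝ) + 1) * cc (w * Hy) (j + 1) - j * cc (w * Hy) j = - cc w j := by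
  rw [cc_mul_y, cc_mul_y]
  have h1 : (j : ℝ) * (-(∑ m ∈ Finset.range j, cc w m) / j) = - ∑ m ∈ Finset.range j, cc w m := by
    rcases Nat.eq_zero_or_pos j with hj | hj
    · subst hj; simp
    · have : (j : ℝ) ≠ 0 := by positivity
      field_simp
  rw [h1, Finset.sum_range_succ _ j]
  have := n1pos j
  push_cast
  field_simp
  ring

/-- Truncated multiple harmonic sums. -/
def ev (w : H) (N : ℕ) : ℝ := ∑ m ∈ Finset.range (N + 1), coef w m

theorem ev_add (v w : H) (N : ℕ) : ev (v + w) N = ev v N + ev w N := by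
  simp [ev, Finset.sum_add_distrib]

theorem ev_smul (r : ℚ) (w : H) (N : ℕ) : ev (r • w) N = r * ev w N := by
  simp [ev, Finset.mul_sum, Rat.smul_def]

theorem ev_succ (w : H) (N : ℕ) : ev w (N + 1) = ev w N + coef w (N + 1) :=
  Finset.sum_range_succ _ _

theorem ev_zero (w : H) : ev w 0 = coef w 0 := by simp [ev]

theorem ev_one (N : ℕ) : ev 1 N = 1 := by
  induction N with
  | zero => rw [ev_zero, coef_one]; simp
  | succ N ih => rw [ev_succ, ih, coef_one]; simp

theorem Ob_ev (w : H) : Ob 0 (ev w) := (Ob_coef w).psum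

/-- `ev_N` in terms of the shifted coefficient sequence. -/
theorem ev_eq {w : H} (h : InY w) (N : ℕ) : ev w N = ∑ M ∈ Finset.range N, coef w (M + 1) := by
  rw [ev, Finset.sum_range_succ', coef_zero_of_InY h, add_zero]

theorem coef_x_succ (w : H) (N : ℕ) : coef (w * Hx) (N + 1) = coef w (N + 1) / ((N : ℝ) + 1) := by
  rw [coef_mul_x]; simp [opX]

theorem coef_y_succ (w : H) (N : ℕ) : coef (w * Hy) (N + 1) = ev w N / ((N : ℝ) + 1) := by
  rw [coef_mul_y]; simp [opY, ev]

def KK (w : H) : Prop := cc w 0 = coef w 0 ∧ ∀ N, nb N (cc w) 1 = - coef w (N + 1)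

theorem KK.ev {w : H} (h : KK w) (N : ℕ) : nb N (cc w) 0 = ev w N := by
  induction N with
  | zero => rw [ev_zero, ← h.1]; rfl
  | succ N ih => rw [nb_succ, ih, h.2, ev_succ]; ring

theorem KK_one : KK 1 := by
  constructor
  · rw [cc_one, coef_one]
  · intro N
    have : nb N (cc 1) (0 + 1) = nb N (fun i => 0 * (0 : ℝ)) (0 + 1) := by
      apply nb_congr
      intro i; rw [cc_one]; simp
    rw [nb_smul N 0 (fun _ => 0)] at this
    simp at this
    rw [this, coef_one]; simp

theorem KK.mul_y {w : H} (h : KK w) : KK (w * Hy) := by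
  constructor
  · rw [cc_mul_y, coef_mul_y]; simp [opY]
  · intro N
    rw [nb_rec_zero (rec_y w), nb_neg, coef_y_succ]
    simp only [h.ev]; ring

theorem KK.of_InY {w : H} (h : InY w) : KK w := by
  refine Hind_Y (C := KK) ?_ ?_ ?_ ?_ ?_ h
  · rw [← one_mul Hy]; exact KK_one.mul_y
  · intro a b ha hb
    refine ⟨?_, fun N => ?_⟩
    · simp only [cc_add, map_add, Pi.add_apply, ha.1, hb.1]
    · simp only [cc_add, nb_add, map_add, Pi.add_apply, ha.2, hb.2]; ring
  · intro r a ha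
    refine ⟨?_, fun N => ?_⟩
    · simp only [cc_smul, map_smul, Pi.smul_apply, ha.1, Rat.smul_def]
    · simp only [cc_smul, nb_smul, map_smul, Pi.smul_apply, ha.2, Rat.smul_def]; ring
  · intro a haY ha
    constructor
    · rw [cc_mul_x, coef_mul_x]; simp [opX]
    · intro N
      rw [nb_rec_zero (rec_x (cc_zero_of_InY haY)), nb_shift N (cc a), coef_x_succ]
      simp only [zero_add, ha.2]
      ring
  · intro a _ ha; exact ha.mul_y

def EE (w : H) (N : ℕ) : ℝ := - ∑' i : ℕ, nb N (cc w) (i + 1) / ((i : ℝ) + 1)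

def GG (w : H) (N : ℕ) : ℝ := ∑' i : ℕ, nb N (cc w) (i + 2) / ((i : ℝ) + 1)

theorem sumE (w : H) (N : ℕ) : Summable (fun i : ℕ => nb N (cc w) (i + 1) / ((i : ℝ) + 1)) :=
  (nb_Ob2 (Ob_cc w) N 0).summable

theorem sumG (w : H) (N : ℕ) : Summable (fun i : ℕ => nb N (cc w) (i + 2) / ((i : ℝ) + 1)) :=
  (nb_Ob2 (Ob_cc w) N 1).summable

theorem EE_succ (w : H) (N : ℕ) : EE w (N + 1) = EE w N + GG w N := by
  have h := ((sumE w N).hasSum.sub (sumG w N).hasSum)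
  have h2 : ∑' i : ℕ, nb (N + 1) (cc w) (i + 1) / ((i : ℝ) + 1) =
      ∑' i : ℕ, nb N (cc w) (i + 1) / ((i : ℝ) + 1) - ∑' i : ℕ, nb N (cc w) (i + 2) / ((i : ℝ) + 1) := by
    rw [← h.tsum_eq]
    apply tsum_congr
    intro i
    rw [nb_succ, sub_div]
  rw [EE, EE, GG, h2]; ring

theorem EE_add (v w : H) (N : ℕ) : EE (v + w) N = EE v N + EE w N := by
  have h := ((sumE v N).hasSum.add (sumE w N).hasSum).tsum_eq
  simp only [EE, cc_add, nb_add, add_div]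
  rw [h]; ring

theorem EE_smul (r : ℚ) (w : H) (N : ℕ) : EE (r • w) N = r * EE w N := by
  simp only [EE, cc_smul, nb_smul, mul_div_assoc, tsum_mul_left]; ring

theorem GG_add (v w : H) (N : ℕ) : GG (v + w) N = GG v N + GG w N := by
  have h := ((sumG v N).hasSum.add (sumG w N).hasSum).tsum_eq
  simp only [GG, cc_add, nb_add, add_div]
  rw [h]

theorem GG_smul (r : ℚ) (w : H) (N : ℕ) : GG (r • w) N = r * GG w N := by
  simp only [GG, cc_smul, nb_smul, mul_div_assoc, tsum_mul_left]

theorem EE_one (N : ℕ) : EE 1 N = 0 := by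
  have : ∀ i, nb N (cc 1) (i + 1) = 0 := by
    intro i
    have : nb N (cc 1) (i + 1) = nb N (fun i => 0 * (0 : ℝ)) (i + 1) := by
      apply nb_congr
      intro i; rw [cc_one]; simp
    rw [this, nb_smul N 0 (fun _ => 0)]; simp
  simp [EE, this]

theorem GG_x {w : H} (h : InY w) (N : ℕ) :
    GG (w * Hx) N = GG w N / ((N : ℝ) + 1) - coef w (N + 1) / ((N : ℝ) + 1) ^ 2 := by
  have h1 := nb_rec_sum (Ob_cc (w * Hx)) ((Ob_cc w).shift le_rfl) (rec_x (cc_zero_of_InY h)) N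
  have h2 := (KK.of_InY (h.mul Hx)).2 N
  rw [h2, nb_shift N (cc w), coef_x_succ] at h1
  have hp := n1pos N
  change ((N : ℝ) + 1) * GG (w * Hx) N = _ + GG w N at h1
  field_simp
  field_simp at h1
  linarith

theorem GG_y {w : H} (h : KK w) (N : ℕ) :
    GG (w * Hy) N = EE w N / ((N : ℝ) + 1) - ev w N / ((N : ℝ) + 1) ^ 2 := by
  have h1 := nb_rec_sum (Ob_cc (w * Hy)) (Ob_cc w).neg (rec_y w) N
  have h2 := h.mul_y.2 N
  rw [h2, nb_neg, coef_y_succ] at h1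
  have hp := n1pos N
  have h3 : ∑' i : ℕ, (fun i => -nb N (cc w) i) (i + 1) / ((i : ℝ) + 1) = EE w N := by
    simp only [neg_div, tsum_neg]; rfl
  rw [h3] at h1
  change ((N : ℝ) + 1) * GG (w * Hy) N = _ at h1
  field_simp
  field_simp at h1
  linarith

/-! ### Complete monotonicity and decay of `EE` -/

def DD (w : H) : Prop := InY w ∧ ∀ N i, nb N (cc w) (i + 1) ≤ 0

theorem nb_nonpos_of_rec {d e : ℕ → ℝ} (h : ∀ j : ℕ, ((j : ℝ) + 1) * d (j + 1) - j * d j = e j)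
    (he : ∀ N j, nb N e j ≤ 0) (j N : ℕ) : nb N d (j + 1) ≤ 0 := by
  induction j generalizing N with
  | zero =>
    rw [zero_add, nb_rec_zero h]
    exact div_nonpos_of_nonpos_of_nonneg (he _ _) (n1pos N).le
  | succ j ih =>
    have h1 := nb_rec h N (j + 1)
    have h2 := mul_nonpos_of_nonneg_of_nonpos (n1pos j).le (ih (N + 1))
    have h3 := he N (j + 1)
    push_cast at h1
    by_contra! hc
    have h4 := mul_pos (n1pos N) hc
    linarith

theorem nb_one_succ (N i : ℕ) : nb N (cc 1) (i + 1) = 0 := by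
  have : nb N (cc 1) (i + 1) = nb N (fun i => 0 * (0 : ℝ)) (i + 1) := by
    apply nb_congr
    intro i; rw [cc_one]; simp
  rw [this, nb_smul N 0 (fun _ => 0)]; simp

theorem DD_y : DD Hy := by
  refine ⟨InY.y, fun N i => ?_⟩
  have h1 := nb_nonpos_of_rec (rec_y 1) ?_ i N
  · rwa [one_mul] at h1
  · intro N j
    rw [nb_neg]
    cases j with
    | zero => simp only [KK_one.ev, ev_one]; norm_num
    | succ j => simp only [nb_one_succ]; norm_num

theorem DD.x {w : H} (h : DD w) : DD (w * Hx) := by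
  refine ⟨h.1.mul _, fun N i => ?_⟩
  refine nb_nonpos_of_rec (rec_x (cc_zero_of_InY h.1)) ?_ i N
  intro N j
  rw [nb_shift N (cc w)]
  exact h.2 N j

theorem DD.xy {w : H} (h : DD w) : DD (w * (Hx + Hy)) := by
  refine ⟨h.1.mul _, fun N => ?_⟩
  have e : (fun j : ℕ => (j : ℝ) * cc (w * (Hx + Hy)) j) = cc w := by
    ext j
    rw [cc_mul_xy]
    rcases Nat.eq_zero_or_pos j with hj | hj
    · subst hj; simp [cc_zero_of_InY h.1]
    · have : (j : ℝ) ≠ 0 := by positivity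
      field_simp
  induction N with
  | zero =>
    intro i
    have := h.2 0 i
    change cc (w * (Hx + Hy)) (i + 1) ≤ 0
    rw [cc_mul_xy]
    apply div_nonpos_of_nonpos_of_nonneg this
    positivity
  | succ N ih =>
    intro i
    have h1 := nb_leibniz N (cc (w * (Hx + Hy))) (i + 1)
    rw [e] at h1
    have h2 := h.2 (N + 1) i
    have h3 := mul_nonpos_of_nonneg_of_nonpos (n1pos N).le (ih (i + 1))
    by_contra! hc
    have h4 := mul_pos (n1pos i) hc
    push_cast at h1
    linarith

theorem nb_tendsto {w : H} (h : InY w) (i : ℕ) :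
    Filter.Tendsto (fun N => nb N (cc w) (i + 1)) Filter.atTop (nhds 0) := by
  induction i with
  | zero =>
    simp only [zero_add, (KK.of_InY h).2]
    exact ((Ob_coef w).shift le_rfl).neg.tendsto
  | succ i ih =>
    have h1 := ih.sub ((Filter.tendsto_add_atTop_iff_nat 1).2 ih)
    simp only [nb_succ, sub_zero, sub_sub_cancel] at h1
    exact h1

theorem DD.tendsto {w : H} (h : DD w) : Filter.Tendsto (EE w) Filter.atTop (nhds 0) := by
  have hb : ∀ N i, |nb N (cc w) (i + 1)| ≤ |cc w (i + 1)| := by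
    intro N i
    induction N with
    | zero => exact le_rfl
    | succ N ih =>
      refine le_trans ?_ ih
      rw [abs_of_nonpos (h.2 _ _), abs_of_nonpos (h.2 _ _), nb_succ]
      have := h.2 N (i + 1)
      linarith
  have hs : Summable (fun i : ℕ => |cc w (i + 1) / ((i : ℝ) + 1)|) := (sumE w 0).abs
  have := tendsto_tsum_of_dominated_convergence (𝓕 := Filter.atTop)
    (f := fun N i => nb N (cc w) (i + 1) / ((i : ℝ) + 1)) (g := fun _ => (0 : ℝ)) hs ?_ ?_
  · have h2 := this.neg
    simp only [tsum_zero, neg_zero] at h2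
    exact h2
  · intro i
    simpa using (nb_tendsto h.1 i).div_const ((i : ℝ) + 1)
  · filter_upwards with N i
    rw [Real.norm_eq_abs, abs_div, abs_div]
    exact div_le_div_of_nonneg_right (hb N i) (abs_nonneg _)

theorem mem_span_DD {w : H} (h : InY w) : w ∈ Submodule.span ℚ {w | DD w} := by
  have hx : ∀ a, a ∈ Submodule.span ℚ {w | DD w} → a * Hx ∈ Submodule.span ℚ {w | DD w} := by
    intro a ha
    induction ha using Submodule.span_induction with
    | mem a ha => exact Submodule.subset_span (DD.x ha)
    | zero => simp
    | add a b _ _ ha hb => rw [add_mul]; exact add_mem ha hb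
    | smul r a _ ha => rw [smul_mul_assoc]; exact Submodule.smul_mem _ _ ha
  have hxy : ∀ a, a ∈ Submodule.span ℚ {w | DD w} →
      a * (Hx + Hy) ∈ Submodule.span ℚ {w | DD w} := by
    intro a ha
    induction ha using Submodule.span_induction with
    | mem a ha => exact Submodule.subset_span (DD.xy ha)
    | zero => simp
    | add a b _ _ ha hb => rw [add_mul]; exact add_mem ha hb
    | smul r a _ ha => rw [smul_mul_assoc]; exact Submodule.smul_mem _ _ ha
  refine Hind_Y (C := fun w => w ∈ Submodule.span ℚ {w | DD w}) ?_ ?_ ?_ ?_ ?_ h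
  · exact Submodule.subset_span DD_y
  · intro a b ha hb; exact add_mem ha hb
  · intro r a ha; exact Submodule.smul_mem _ _ ha
  · intro a _ ha; exact hx a ha
  · intro a _ ha
    have : a * Hy = a * (Hx + Hy) - a * Hx := by rw [mul_add]; abel
    rw [this]
    exact sub_mem (hxy a ha) (hx a ha)

theorem EE_zero_elt (N : ℕ) : EE 0 N = 0 := by
  have := EE_smul 0 0 N
  simpa using this

theorem EE_tendsto {w : H} (h : InY w) : Filter.Tendsto (EE w) Filter.atTop (nhds 0) := by
  have := mem_span_DD h
  clear h
  induction this using Submodule.span_induction with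
  | mem a ha => exact DD.tendsto ha
  | zero => rw [funext EE_zero_elt]; exact tendsto_const_nhds
  | add a b _ _ ha hb =>
    rw [funext (EE_add a b)]
    simpa using ha.add hb
  | smul r a _ ha =>
    rw [funext (EE_smul r a)]
    simpa using ha.const_mul (r : ℝ)

theorem tail_tendsto {h : ℕ → ℝ} (hh : Ob (-2) h) : Filter.Tendsto (tail h) Filter.atTop (nhds 0) :=
  hh.tail.tendsto

theorem EE_eq_tail' {w : H} (h : InY w) (hG : Ob (-2) (GG w)) (N : ℕ) : EE w N = - tail (GG w) N := by
  have h1 : ∀ N, EE w N + tail (GG w) N = EE w 0 + tail (GG w) 0 := by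
    intro N
    induction N with
    | zero => rfl
    | succ N ih =>
      rw [← ih, EE_succ, tail_succ hG.summable N]; ring
  have h2 := (EE_tendsto h).add hG.tail.tendsto
  simp only [h1, add_zero] at h2
  have h3 := tendsto_nhds_unique h2 tendsto_const_nhds
  have := h1 N
  linarith

theorem Ob_EE' {w : H} (h : InY w) (hG : Ob (-2) (GG w)) : Ob (-1) (EE w) :=
  hG.tail.neg.congr (EE_eq_tail' h hG)

theorem Ob_GG {w : H} (h : InY w) : Ob (-2) (GG w) := by
  have := Hind_Y (C := fun w => InY w ∧ Ob (-2) (GG w)) ?_ ?_ ?_ ?_ ?_ h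
  · exact this.2
  · refine ⟨InY.y, ?_⟩
    have := ((Ob.const 1).div2).neg
    norm_num at this
    refine this.congr (fun N => ?_)
    rw [← one_mul Hy, GG_y KK_one, EE_one, ev_one]
    ring
  · intro a b ha hb
    exact ⟨ha.1.add hb.1, (ha.2.add hb.2).congr (GG_add a b)⟩
  · intro r a ha
    exact ⟨ha.1.smul r, (ha.2.smul r).congr (GG_smul r a)⟩
  · intro a ha h
    refine ⟨ha.mul _, ?_⟩
    have h1 := (h.2.div).mono (show (-2 : ℝ) - 1 ≤ -2 by norm_num)
    have h2 := ((Ob_coef a).shift le_rfl).div2.mono (show (-1 : ℝ) - 2 ≤ -2 by norm_num)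
    exact (h1.sub h2).congr (GG_x ha)
  · intro a ha h
    refine ⟨ha.mul _, ?_⟩
    have h1 := ((Ob_EE' ha h.2).div).mono (show (-1 : ℝ) - 1 ≤ -2 by norm_num)
    have h2 := (Ob_ev a).div2.mono (show (0 : ℝ) - 2 ≤ -2 by norm_num)
    exact (h1.sub h2).congr (GG_y (KK.of_InY ha))

theorem Ob_EE {w : H} (h : InY w) : Ob (-1) (EE w) := Ob_EE' h (Ob_GG h)

theorem EE_eq_tail {w : H} (h : InY w) (N : ℕ) : EE w N = - tail (GG w) N :=
  EE_eq_tail' h (Ob_GG h) N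

theorem EE_eq_sum {w : H} (h : InY w) : EE w 0 = - ∑' N, GG w N := by
  rw [EE_eq_tail h]; simp [tail]

/-! ### Words and multiple zeta values -/

/-- The word `z_{a₁+1} ⋯ z_{a_r+1}`. -/
def zw (l : List ℕ) : H := (l.map (fun a => Hy * Hx ^ a)).prod

theorem zw_nil : zw [] = 1 := rfl

theorem zw_cons (a : ℕ) (l : List ℕ) : zw (a :: l) = Hy * Hx ^ a * zw l := by simp [zw]

theorem zw_append (l m : List ℕ) : zw (l ++ m) = zw l * zw m := by simp [zw]

theorem zw_snoc (l : List ℕ) (a : ℕ) : zw (l ++ [a]) = zw l * Hy * Hx ^ a := by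
  simp [zw, mul_assoc]

theorem InY_zw_cons (a : ℕ) (l : List ℕ) : InY (zw (a :: l)) :=
  ⟨Hx ^ a * zw l, by rw [zw_cons, mul_assoc]⟩

theorem InY_zw_snoc (l : List ℕ) (a : ℕ) : InY (zw (l ++ [a])) := by
  cases l with
  | nil => exact InY_zw_cons _ _
  | cons b l => exact InY_zw_cons _ _

theorem coef_mul_pow (w : H) (a m : ℕ) :
    coef (w * Hx ^ a) (m + 1) = coef w (m + 1) / ((m : ℝ) + 1) ^ a := by
  induction a with
  | zero => simp
  | succ a ih =>
    rw [pow_succ, ← mul_assoc, coef_x_succ, ih, pow_succ, div_div]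

theorem coef_zw_snoc (w : H) (a m : ℕ) :
    coef (w * Hy * Hx ^ a) (m + 1) = ev w m / ((m : ℝ) + 1) ^ (a + 1) := by
  rw [coef_mul_pow, coef_y_succ, div_div, pow_succ, mul_comm]

theorem InY_mem_span {w : H} (h : InY w) :
    w ∈ Submodule.span ℚ {w | ∃ l a, w = zw (l ++ [a])} := by
  refine Hind_Y (C := fun w => w ∈ Submodule.span ℚ {w | ∃ l a, w = zw (l ++ [a])}) ?_ ?_ ?_ ?_ ?_ h
  · exact Submodule.subset_span ⟨[], 0, by simp [zw]⟩
  · intro a b ha hb; exact add_mem ha hb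
  · intro r a ha; exact Submodule.smul_mem _ _ ha
  · intro a haY ha
    clear haY
    induction ha using Submodule.span_induction with
    | mem w hw =>
      obtain ⟨l, a, rfl⟩ := hw
      exact Submodule.subset_span ⟨l, a + 1, by rw [zw_snoc, zw_snoc, pow_succ]; simp only [mul_assoc]⟩
    | zero => simp
    | add a b _ _ ha hb => rw [add_mul]; exact add_mem ha hb
    | smul r a _ ha => rw [smul_mul_assoc]; exact Submodule.smul_mem _ _ ha
  · intro a haY ha
    clear haY
    induction ha using Submodule.span_induction with
    | mem w hw =>
      obtain ⟨l, a, rfl⟩ := hw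
      exact Submodule.subset_span ⟨l ++ [a], 0, by rw [zw_snoc (l ++ [a]), pow_zero, mul_one]⟩
    | zero => simp
    | add a b _ _ ha hb => rw [add_mul]; exact add_mem ha hb
    | smul r a _ ha => rw [smul_mul_assoc]; exact Submodule.smul_mem _ _ ha

def mzw (r : ℕ) (k : Fin r → ℕ) (n : Fin r → ℕ) : ENNReal :=
  if (∀ i, 0 < n i) ∧ StrictMono n then ∏ i, ENNReal.ofReal (1 / (n i : ℝ) ^ (k i)) else 0

def tE (r : ℕ) (k : Fin r → ℕ) (N : ℕ) : ENNReal :=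
  ∑' n : Fin r → ℕ, if ∀ i, n i ≤ N then mzw r k n else 0

theorem strictMono_snoc {r : ℕ} (n : Fin r → ℕ) (m : ℕ) :
    StrictMono (Fin.snoc n m : Fin (r + 1) → ℕ) ↔ StrictMono n ∧ ∀ i, n i < m := by
  constructor
  · intro h
    constructor
    · intro i j hij
      have := h (show i.castSucc < j.castSucc from hij)
      simpa using this
    · intro i
      have := h (Fin.castSucc_lt_last i)
      simpa using this
  · rintro ⟨h1, h2⟩ i j hij
    induction j using Fin.lastCases with
    | last =>
      induction i using Fin.lastCases with
      | last => exact absurd hij (lt_irrefl _)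
      | cast i => simpa using h2 i
    | cast j =>
      induction i using Fin.lastCases with
      | last => exact absurd hij (not_lt_of_gt (Fin.castSucc_lt_last j))
      | cast i => simpa using h1 hij

theorem mzw_snoc (r : ℕ) (k : Fin (r + 1) → ℕ) (n : Fin r → ℕ) (m : ℕ) :
    mzw (r + 1) k (Fin.snoc n m : Fin (r + 1) → ℕ) =
      if 0 < m then ENNReal.ofReal (1 / (m : ℝ) ^ k (Fin.last r)) *
        (if ∀ i, n i ≤ m - 1 then mzw r (fun i => k i.castSucc) n else 0) else 0 := by
  rw [mzw, Fin.prod_univ_castSucc]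
  simp only [strictMono_snoc, Fin.forall_fin_succ', Fin.snoc_castSucc, Fin.snoc_last]
  by_cases hm : 0 < m
  · have e : (∀ i, n i ≤ m - 1) ↔ ∀ i, n i < m := by
      refine forall_congr' (fun i => ?_); omega
    simp only [e]
    rw [if_pos hm, mzw]
    by_cases h1 : ∀ i, n i < m
    · by_cases h2 : (∀ i, 0 < n i) ∧ StrictMono n
      · rw [if_pos ⟨⟨h2.1, hm⟩, h2.2, h1⟩, if_pos h1, if_pos h2, mul_comm]
      · rw [if_neg (fun h => h2 ⟨h.1.1, h.2.1⟩), if_pos h1, if_neg h2, mul_zero]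
    · rw [if_neg (fun h => h1 h.2.2), if_neg h1, mul_zero]
  · rw [if_neg (fun h => hm h.1.2), if_neg hm]

theorem tsum_pos_shift (f : ℕ → ENNReal) : ∑' m, (if 0 < m then f m else 0) = ∑' m, f (m + 1) := by
  rw [tsum_eq_zero_add' ENNReal.summable]; simp

theorem tsum_mzw (r : ℕ) (k : Fin (r + 1) → ℕ) (P : ℕ → Prop) [DecidablePred P] :
    ∑' n : Fin (r + 1) → ℕ, (if P (n (Fin.last r)) then mzw (r + 1) k n else 0) =
      ∑' m : ℕ, if P (m + 1) then ENNReal.ofReal (1 / ((m : ℝ) + 1) ^ k (Fin.last r)) *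
        tE r (fun i => k i.castSucc) m else 0 := by
  rw [← (Fin.snocEquiv (fun _ => ℕ)).tsum_eq, ENNReal.tsum_prod']
  have e0 : ∀ (m : ℕ) (n : Fin r → ℕ), (Fin.snocEquiv (fun _ : Fin (r + 1) => ℕ)) (m, n) =
      (Fin.snoc n m : Fin (r + 1) → ℕ) := fun _ _ => rfl
  simp only [e0, Fin.snoc_last, mzw_snoc]
  have e : ∀ m : ℕ, (∑' n : Fin r → ℕ, if P m then (if 0 < m then
      ENNReal.ofReal (1 / (m : ℝ) ^ k (Fin.last r)) *
        (if ∀ i, n i ≤ m - 1 then mzw r (fun i => k i.castSucc) n else 0) else 0) else 0) =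
      if 0 < m then (if P m then ENNReal.ofReal (1 / (m : ℝ) ^ k (Fin.last r)) *
        tE r (fun i => k i.castSucc) (m - 1) else 0) else 0 := by
    intro m
    by_cases hm : 0 < m <;> by_cases hP : P m <;>
      simp only [hm, hP, tE, ENNReal.tsum_mul_left, if_true, if_false, tsum_zero]
  refine (tsum_congr e).trans ?_
  rw [tsum_pos_shift]
  simp

theorem ev_nonneg_zw (l : List ℕ) (N : ℕ) : 0 ≤ ev (zw l) N := by
  induction l using List.reverseRecOn generalizing N with
  | nil => rw [zw_nil, ev_one]; norm_num
  | append_singleton l a ih =>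
    rw [ev_eq (InY_zw_snoc l a)]
    apply Finset.sum_nonneg
    intro M _
    rw [zw_snoc, coef_zw_snoc]
    exact div_nonneg (ih M) (by positivity)

theorem ofFn_snoc' {r : ℕ} (b : Fin (r + 1) → ℕ) :
    List.ofFn b = List.ofFn (fun i : Fin r => b i.castSucc) ++ [b (Fin.last r)] := by
  rw [List.ofFn_succ', List.concat_eq_append]

theorem tE_eq (r : ℕ) (b : Fin r → ℕ) (N : ℕ) :
    tE r (fun i => b i + 1) N = ENNReal.ofReal (ev (zw (List.ofFn b)) N) := by
  induction r generalizing N with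
  | zero =>
    rw [tE, tsum_fintype]
    simp [mzw, zw_nil, ev_one, Subsingleton.strictMono]
  | succ r ih =>
    have e : tE (r + 1) (fun i => b i + 1) N =
        ∑' n : Fin (r + 1) → ℕ, (if n (Fin.last r) ≤ N then mzw (r + 1) (fun i => b i + 1) n else 0) := by
      rw [tE]
      refine tsum_congr (fun n => ?_)
      by_cases h1 : n (Fin.last r) ≤ N
      · rw [if_pos h1]
        by_cases h2 : StrictMono n
        · rw [if_pos]
          intro i
          exact (h2.monotone (Fin.le_last i)).trans h1
        · have : mzw (r + 1) (fun i => b i + 1) n = 0 := by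
            rw [mzw, if_neg (fun h => h2 h.2)]
          simp [this]
      · rw [if_neg h1, if_neg (fun h => h1 (h _))]
    rw [e, tsum_mzw r _ (fun m => m ≤ N), ofFn_snoc', ev_eq (InY_zw_snoc _ _),
      ENNReal.ofReal_sum_of_nonneg]
    · rw [tsum_eq_sum (s := Finset.range N)]
      · refine Finset.sum_congr rfl (fun M hM => ?_)
        rw [if_pos (by simpa using hM), ih, zw_snoc, coef_zw_snoc,
          ← ENNReal.ofReal_mul (by positivity)]
        congr 1; ring
      · intro M hM
        rw [if_neg]
        simpa using hM
    · intro M _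
      rw [zw_snoc, coef_zw_snoc]
      exact div_nonneg (ev_nonneg_zw _ M) (by positivity)

theorem MZV_eq (r : ℕ) (b : Fin (r + 1) → ℕ) :
    MZV (r + 1) (fun i => b i + 1) =
      ∑' m : ℕ, ev (zw (List.ofFn (fun i : Fin r => b i.castSucc))) m /
        ((m : ℝ) + 1) ^ (b (Fin.last r) + 1) := by
  have h1 := tsum_mzw r (fun i => b i + 1) (fun _ => True)
  simp only [if_true] at h1
  have h2 : MZV (r + 1) (fun i => b i + 1) =
      (∑' n : Fin (r + 1) → ℕ, mzw (r + 1) (fun i => b i + 1) n).toReal := by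
    rw [MZV, ENNReal.tsum_toReal_eq]
    · have := tsum_subtype {n : Fin (r + 1) → ℕ | (∀ i, 0 < n i) ∧ StrictMono n}
        (fun n => ∏ i, (1 : ℝ) / (n i : ℝ) ^ (b i + 1))
      refine Eq.trans this ?_
      refine tsum_congr (fun n => ?_)
      rw [mzw, Set.indicator_apply]
      simp only [Set.mem_ofPred_eq]
      split_ifs
      · rw [ENNReal.toReal_prod]
        refine Finset.prod_congr rfl (fun i _ => ?_)
        rw [ENNReal.toReal_ofReal (by positivity)]
      · simp
    · intro n
      rw [mzw]
      split_ifs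
      · exact ENNReal.prod_ne_top (fun i _ => ENNReal.ofReal_ne_top)
      · simp
  rw [h2, h1, ENNReal.tsum_toReal_eq]
  · refine tsum_congr (fun m => ?_)
    rw [tE_eq, ← ENNReal.ofReal_mul (by positivity), ENNReal.toReal_ofReal]
    · ring
    · have := ev_nonneg_zw (List.ofFn (fun i : Fin r => b i.castSucc)) m
      positivity
  · intro m
    rw [tE_eq]
    exact ENNReal.mul_ne_top ENNReal.ofReal_ne_top ENNReal.ofReal_ne_top

theorem Z_zw {Z : H →ₗ[ℚ] ℝ} (hZ : IsZetaMap Z) (l : List ℕ) (a : ℕ) :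
    Z (zw (l ++ [a + 1])) = ∑' m : ℕ, ev (zw l) m / ((m : ℝ) + 1) ^ (a + 2) := by
  have h := hZ l.length (fun i => (Fin.snoc l.get (a + 1) : Fin (l.length + 1) → ℕ) i + 1)
    (fun i => by omega) (by simp)
  rw [MZV_eq] at h
  simp only [Fin.snoc_castSucc, Fin.snoc_last, List.ofFn_get, add_tsub_cancel_right] at h
  rw [← h]
  congr 1
  rw [List.ofFn_succ', List.concat_eq_append]
  simp only [Fin.snoc_castSucc, Fin.snoc_last]
  have : l.map (fun a => Hy * Hx ^ a) = List.ofFn (fun i => Hy * Hx ^ l.get i) := by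
    conv_lhs => rw [← List.ofFn_get l]
    rw [List.map_ofFn]; rfl
  rw [← this, zw]
  simp

theorem Z_eq {Z : H →ₗ[ℚ] ℝ} (hZ : IsZetaMap Z) {w : H} (h : InY w) :
    Z (w * Hx) = ∑' m : ℕ, coef w (m + 1) / ((m : ℝ) + 1) := by
  have hs : ∀ w : H, Summable (fun m : ℕ => coef w (m + 1) / ((m : ℝ) + 1)) := by
    intro w
    have := ((Ob_coef w).shift le_rfl).div.mono (show (-1 : ℝ) - 1 ≤ -2 by norm_num)
    exact this.summable
  have := InY_mem_span h
  clear h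
  induction this using Submodule.span_induction with
  | mem w hw =>
    obtain ⟨l, a, rfl⟩ := hw
    have e : zw (l ++ [a]) * Hx = zw (l ++ [a + 1]) := by
      rw [zw_snoc, zw_snoc, pow_succ]; simp only [mul_assoc]
    rw [e, Z_zw hZ]
    refine tsum_congr (fun m => ?_)
    rw [zw_snoc, coef_zw_snoc, div_div, ← pow_succ]
  | zero => simp
  | add a b _ _ ha hb =>
    rw [add_mul, map_add, ha, hb, ← (hs a).tsum_add (hs b)]
    simp [add_div]
  | smul r a _ ha =>
    rw [smul_mul_assoc, map_smul, ha, Rat.smul_def, ← tsum_mul_left]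
    simp [Rat.smul_def, mul_div_assoc]

theorem Z_phi {Z : H →ₗ[ℚ] ℝ} (hZ : IsZetaMap Z) {w : H} (h : InY w) :
    Z (phi w * Hx) = - EE w 0 := by
  rw [Z_eq hZ h.phi, EE, neg_neg]; rfl

/-! ### The harmonic product on words -/

def zz (a : ℕ) : H := Hy * Hx ^ a

theorem zw_cons' (a : ℕ) (l : List ℕ) : zw (a :: l) = zz a * zw l := zw_cons a l

theorem zw_snoc' (l : List ℕ) (a : ℕ) : zw (l ++ [a]) = zw l * zz a := by
  rw [zw_snoc, zz, mul_assoc]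

section harm
variable {st : H →ₗ[ℚ] H →ₗ[ℚ] H}

theorem st_pow_left (hst : IsHarmonic st) (a : ℕ) (u v : H) : st (Hx ^ a * u) v = Hx ^ a * st u v := by
  induction a with
  | zero => simp
  | succ a ih => rw [pow_succ', mul_assoc, hst.2.2.1, ih, mul_assoc]

theorem st_pow_right (hst : IsHarmonic st) (a : ℕ) (u v : H) : st u (Hx ^ a * v) = Hx ^ a * st u v := by
  induction a with
  | zero => simp
  | succ a ih => rw [pow_succ', mul_assoc, hst.2.2.2.1, ih, mul_assoc]

theorem st_zL (hst : IsHarmonic st) (c d : ℕ) (u v : H) :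
    st (zz c * u) (zz d * v) =
      zz c * st u (zz d * v) + zz d * st (zz c * u) v + zz (c + d + 1) * st u v := by
  simp only [zz, mul_assoc]
  rw [hst.2.2.2.2, st_pow_left hst, st_pow_right hst, st_pow_left hst, st_pow_right hst,
    mul_add, mul_add]
  congr 2
  rw [show c + d + 1 = 1 + c + d by ring, pow_add, pow_add, pow_one]
  simp only [mul_assoc]

theorem st_zR (hst : IsHarmonic st) (a b : ℕ) (l m : List ℕ) :
    st (zw l * zz a) (zw m * zz b) =
      st (zw l) (zw m * zz b) * zz a + st (zw l * zz a) (zw m) * zz b +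
        st (zw l) (zw m) * zz (a + b + 1) := by
  induction l generalizing m with
  | nil =>
    induction m with
    | nil =>
      have := st_zL hst a b 1 1
      simp only [zw_nil, one_mul, mul_one, hst.1, hst.2.1] at this ⊢
      rw [this]; abel
    | cons d m ih =>
      simp only [zw_nil, zw_cons', one_mul, mul_assoc, hst.2.1] at ih ⊢
      have h1 := st_zL hst a d 1 (zw m * zz b)
      have h2 := st_zL hst a d 1 (zw m)
      simp only [mul_one, hst.2.1] at h1 h2
      rw [h1, h2, ih]
      simp only [mul_add, add_mul, mul_assoc]
      abel
  | cons c l ihl =>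
    induction m with
    | nil =>
      have ih := ihl []
      simp only [zw_nil, zw_cons', one_mul, mul_assoc, hst.1] at ih ⊢
      have h1 := st_zL hst c b (zw l * zz a) 1
      have h2 := st_zL hst c b (zw l) 1
      simp only [mul_one, hst.1] at h1 h2
      rw [h1, h2, ih]
      simp only [mul_add, add_mul, mul_assoc]
      abel
    | cons d m ih =>
      have i1 := ihl m
      have i2 := ihl (d :: m)
      simp only [zw_cons', mul_assoc] at ih i1 i2 ⊢
      rw [st_zL hst c d (zw l * zz a) (zw m * zz b), st_zL hst c d (zw l) (zw m * zz b),
        st_zL hst c d (zw l * zz a) (zw m), st_zL hst c d (zw l) (zw m), ih, i1, i2]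
      simp only [mul_add, add_mul, mul_assoc]
      abel

def H1 : Submodule ℚ H := Submodule.span ℚ {w | ∃ l, w = zw l}

theorem zw_mem_H1 (l : List ℕ) : zw l ∈ H1 := Submodule.subset_span ⟨l, rfl⟩

theorem zz_mul_H1 (c : ℕ) {w : H} (h : w ∈ H1) : zz c * w ∈ H1 := by
  induction h using Submodule.span_induction with
  | mem w hw =>
    obtain ⟨l, rfl⟩ := hw
    rw [← zw_cons']; exact zw_mem_H1 _
  | zero => simp
  | add a b _ _ ha hb => rw [mul_add]; exact add_mem ha hb
  | smul r a _ ha => rw [mul_smul_comm]; exact Submodule.smul_mem _ _ ha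

theorem st_mem_H1 (hst : IsHarmonic st) (l m : List ℕ) : st (zw l) (zw m) ∈ H1 := by
  induction l generalizing m with
  | nil => rw [zw_nil, hst.2.1]; exact zw_mem_H1 _
  | cons c l ihl =>
    induction m with
    | nil => rw [zw_nil, hst.1]; exact zw_mem_H1 _
    | cons d m ih =>
      have i1 := ihl m
      have i2 := ihl (d :: m)
      simp only [zw_cons'] at ih i1 i2 ⊢
      rw [st_zL hst]
      exact add_mem (add_mem (zz_mul_H1 _ i2) (zz_mul_H1 _ ih)) (zz_mul_H1 _ i1)

theorem st_InY (hst : IsHarmonic st) {u v : H} (hu : InY u) (hv : InY v) : InY (st u v) := by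
  obtain ⟨p, rfl⟩ := hu
  obtain ⟨q, rfl⟩ := hv
  rw [hst.2.2.2.2]
  exact ⟨_, rfl⟩

theorem quasi (hst : IsHarmonic st) {R : Type} [CommRing R] (F : H → ℕ → R)
    (hadd : ∀ v w N, F (v + w) N = F v N + F w N) (t : ℕ → R) (h1 : ∀ N, F 1 N = 1)
    (hrec : ∀ w ∈ H1, ∀ k N, F (w * zz k) (N + 1) = F (w * zz k) N + t N ^ (k + 1) * F w N)
    (hconst : ∀ u v, InY u → InY v →
      (∀ N, F (st u v) N - F u N * F v N = F (st u v) 0 - F u 0 * F v 0) →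
      F (st u v) 0 - F u 0 * F v 0 = 0) (l m : List ℕ) (N : ℕ) :
    F (st (zw l) (zw m)) N = F (zw l) N * F (zw m) N := by
  induction l using List.reverseRecOn generalizing m N with
  | nil => rw [zw_nil, hst.2.1, h1, one_mul]
  | append_singleton l a ihl =>
    induction m using List.reverseRecOn generalizing N with
    | nil => rw [zw_nil, hst.1, h1, mul_one]
    | append_singleton m b ih =>
      have key : ∀ N, F (st (zw (l ++ [a])) (zw (m ++ [b]))) N - F (zw (l ++ [a])) N * F (zw (m ++ [b])) N =
          F (st (zw (l ++ [a])) (zw (m ++ [b]))) 0 - F (zw (l ++ [a])) 0 * F (zw (m ++ [b])) 0 := by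
        intro N
        induction N with
        | zero => rfl
        | succ N ihN =>
          rw [← ihN]
          have e1 := ihl (m ++ [b]) N
          have e2 := ih N
          have e3 := ihl m N
          have m1 := st_mem_H1 hst l (m ++ [b])
          have m2 := st_mem_H1 hst (l ++ [a]) m
          have m3 := st_mem_H1 hst l m
          have m4 := zw_mem_H1 l
          have m5 := zw_mem_H1 m
          simp only [zw_snoc'] at e1 e2 e3 m1 m2 m3 ⊢
          rw [st_zR hst]
          simp only [hadd]
          rw [hrec _ m1, hrec _ m2, hrec _ m3, hrec _ m4, hrec _ m5, e1, e2, e3]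
          ring
      have h0 := hconst _ _ (InY_zw_snoc l a) (InY_zw_snoc m b) key
      have := key N
      rw [h0, sub_eq_zero] at this
      exact this

theorem ev_rec (w : H) (k N : ℕ) :
    ev (w * zz k) (N + 1) = ev (w * zz k) N + (1 / ((N : ℝ) + 1)) ^ (k + 1) * ev w N := by
  rw [ev_succ, zz, ← mul_assoc, coef_zw_snoc]; simp; ring

theorem ev_st_zw (hst : IsHarmonic st) (l m : List ℕ) (N : ℕ) :
    ev (st (zw l) (zw m)) N = ev (zw l) N * ev (zw m) N := by
  refine quasi hst ev ev_add (fun N => 1 / ((N : ℝ) + 1)) ev_one (fun w _ k N => ev_rec w k N) ?_ l m N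
  intro u v hu hv _
  rw [ev_zero, ev_zero, ev_zero, coef_zero_of_InY hu, coef_zero_of_InY (st_InY hst hu hv)]
  simp

theorem bilin_ext {P Q : H →ₗ[ℚ] H →ₗ[ℚ] ℝ} (h : ∀ l m, P (zw l) (zw m) = Q (zw l) (zw m))
    {u v : H} (hu : InY u) (hv : InY v) : P u v = Q u v := by
  have h1 := InY_mem_span hu
  have h2 := InY_mem_span hv
  clear hu hv
  induction h1 using Submodule.span_induction with
  | mem u hu =>
    obtain ⟨l, a, rfl⟩ := hu
    induction h2 using Submodule.span_induction with
    | mem v hv =>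
      obtain ⟨m, b, rfl⟩ := hv
      exact h _ _
    | zero => simp
    | add a b _ _ ha hb => rw [map_add, map_add, ha, hb]
    | smul r a _ ha => rw [map_smul, map_smul, ha]
  | zero => simp
  | add a b _ _ ha hb => rw [map_add, map_add, LinearMap.add_apply, LinearMap.add_apply, ha, hb]
  | smul r a _ ha => rw [map_smul, map_smul, LinearMap.smul_apply, LinearMap.smul_apply, ha]

def evL (N : ℕ) : H →ₗ[ℚ] ℝ where
  toFun w := ev w N
  map_add' v w := ev_add v w N
  map_smul' r w := by simp [ev_smul, Rat.smul_def]

def EEL (N : ℕ) : H →ₗ[ℚ] ℝ where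
  toFun w := EE w N
  map_add' v w := EE_add v w N
  map_smul' r w := by simp [EE_smul, Rat.smul_def]

theorem ev_st (hst : IsHarmonic st) {u v : H} (hu : InY u) (hv : InY v) (N : ℕ) :
    ev (st u v) N = ev u N * ev v N := by
  have := bilin_ext (P := st.compr₂ (evL N)) (Q := (LinearMap.mul ℚ ℝ).compl₁₂ (evL N) (evL N))
    (fun l m => ev_st_zw hst l m N) hu hv
  exact this

theorem KK_H1 {w : H} (h : w ∈ H1) : KK w := by
  induction h using Submodule.span_induction with
  | mem w hw =>
    obtain ⟨l, rfl⟩ := hw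
    cases l with
    | nil => exact KK_one
    | cons a l => exact KK.of_InY (InY_zw_cons a l)
  | zero => exact KK.of_InY ⟨0, by simp⟩
  | add a b _ _ ha hb => 
    refine ⟨?_, fun N => ?_⟩
    · simp only [cc_add, map_add, Pi.add_apply, ha.1, hb.1]
    · simp only [cc_add, nb_add, map_add, Pi.add_apply, ha.2, hb.2]; ring
  | smul r a _ ha =>
    refine ⟨?_, fun N => ?_⟩
    · simp only [cc_smul, map_smul, Pi.smul_apply, ha.1, Rat.smul_def]
    · simp only [cc_smul, nb_smul, map_smul, Pi.smul_apply, ha.2, Rat.smul_def]; ring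

theorem H1_InY {w : H} (h : w ∈ H1) : InY (w * Hy) := by
  induction h using Submodule.span_induction with
  | mem w hw =>
    obtain ⟨l, rfl⟩ := hw
    have := InY_zw_snoc l 0
    rwa [zw_snoc, pow_zero, mul_one] at this
  | zero => exact ⟨0, by simp⟩
  | add a b _ _ ha hb => rw [add_mul]; exact ha.add hb
  | smul r a _ ha => rw [smul_mul_assoc]; exact ha.smul r

theorem GG_pow {w : H} (h : InY w) (k N : ℕ) :
    GG (w * Hx ^ k) N = GG w N / ((N : ℝ) + 1) ^ k - k * coef w (N + 1) / ((N : ℝ) + 1) ^ (k + 1) := by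
  induction k with
  | zero => simp
  | succ k ih =>
    rw [pow_succ, ← mul_assoc, GG_x (h.mul _), ih, coef_mul_pow]
    have := n1pos N
    push_cast
    field_simp
    ring

theorem EE_rec {w : H} (h : w ∈ H1) (k N : ℕ) :
    EE (w * zz k) (N + 1) = EE (w * zz k) N + (1 / ((N : ℝ) + 1)) ^ (k + 1) * EE w N
      - (k + 1) * (1 / ((N : ℝ) + 1)) ^ (k + 2) * ev w N := by
  rw [EE_succ, zz, ← mul_assoc, GG_pow (H1_InY h), GG_y (KK_H1 h), coef_y_succ]
  have := n1pos N
  simp only [one_div, inv_pow]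
  field_simp
  ring

def FD (w : H) (N : ℕ) : DualNumber ℝ := (ev w N, EE w N)

def tD (N : ℕ) : DualNumber ℝ := (1 / ((N : ℝ) + 1), - (1 / ((N : ℝ) + 1)) ^ 2)

theorem EE_st_zw (hst : IsHarmonic st) (l m : List ℕ) (N : ℕ) :
    EE (st (zw l) (zw m)) N = ev (zw l) N * EE (zw m) N + EE (zw l) N * ev (zw m) N := by
  have hsnd : ∀ u v N, (FD u N * FD v N).snd = ev u N * EE v N + EE u N * ev v N := by
    intro u v N
    rw [TrivSqZeroExt.snd_mul]
    simp [FD, TrivSqZeroExt.fst, TrivSqZeroExt.snd, mul_comm]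
  have hfst : ∀ u v N, (FD u N * FD v N).fst = ev u N * ev v N := by
    intro u v N
    rw [TrivSqZeroExt.fst_mul]; rfl
  have key := quasi hst FD ?_ tD ?_ ?_ ?_ l m N
  · have := congrArg TrivSqZeroExt.snd key
    rw [hsnd] at this
    exact this
  · intro v w N
    apply TrivSqZeroExt.ext
    · exact ev_add v w N
    · exact EE_add v w N
  · intro N
    apply TrivSqZeroExt.ext
    · exact ev_one N
    · exact EE_one N
  · intro w hw k N
    apply TrivSqZeroExt.ext
    · rw [TrivSqZeroExt.fst_add, TrivSqZeroExt.fst_mul, TrivSqZeroExt.fst_pow]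
      exact ev_rec w k N
    · rw [TrivSqZeroExt.snd_add, TrivSqZeroExt.snd_mul, TrivSqZeroExt.snd_pow, TrivSqZeroExt.fst_pow]
      refine (EE_rec hw k N).trans ?_
      simp [FD, tD, TrivSqZeroExt.fst, TrivSqZeroExt.snd]
      have := n1pos N
      field_simp
      ring
  · intro u v hu hv hc
    apply TrivSqZeroExt.ext
    · rw [TrivSqZeroExt.fst_sub, hfst]
      change ev (st u v) 0 - _ = 0
      rw [ev_st hst hu hv]; ring
    · have hc' : ∀ N, EE (st u v) N - (ev u N * EE v N + EE u N * ev v N) =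
          EE (st u v) 0 - (ev u 0 * EE v 0 + EE u 0 * ev v 0) := by
        intro N
        have := congrArg TrivSqZeroExt.snd (hc N)
        rw [TrivSqZeroExt.snd_sub, TrivSqZeroExt.snd_sub, hsnd, hsnd] at this
        exact this
      rw [TrivSqZeroExt.snd_sub, hsnd]
      change EE (st u v) 0 - _ = 0
      have o1 := (Ob_ev u).mul (Ob_EE hv)
      have o2 := (Ob_EE hu).mul (Ob_ev v)
      rw [zero_add] at o1
      rw [add_zero] at o2
      have o3 := ((Ob_EE (st_InY hst hu hv)).sub (o1.add o2)).tendsto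
      simp only [hc'] at o3
      exact tendsto_nhds_unique tendsto_const_nhds o3

theorem EE_st (hst : IsHarmonic st) {u v : H} (hu : InY u) (hv : InY v) (N : ℕ) :
    EE (st u v) N = ev u N * EE v N + EE u N * ev v N := by
  have := bilin_ext (P := st.compr₂ (EEL N))
    (Q := (LinearMap.mul ℚ ℝ).compl₁₂ (evL N) (EEL N) + (LinearMap.mul ℚ ℝ).compl₁₂ (EEL N) (evL N))
    (fun l m => EE_st_zw hst l m N) hu hv
  exact this

/-- Kawashima's relation. -/
theorem EE_st_zero (hst : IsHarmonic st) {u v : H} (hu : InY u) (hv : InY v) : EE (st u v) 0 = 0 := by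
  rw [EE_st hst hu hv, ev_zero, ev_zero, coef_zero_of_InY hu, coef_zero_of_InY hv]; simp

theorem coef_st (hst : IsHarmonic st) {u v : H} (hu : InY u) (hv : InY v) (m : ℕ) :
    coef (st u v) (m + 1) = coef u (m + 1) * ev v (m + 1) + ev u m * coef v (m + 1) := by
  have h1 := ev_succ (st u v) m
  rw [ev_st hst hu hv, ev_st hst hu hv, ev_succ u, ev_succ v] at h1
  rw [ev_succ v]
  linarith

end harm

/-! ### `A₁ ⊆ A₆` -/

section
variable {st : H →ₗ[ℚ] H →ₗ[ℚ] H}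

def S0 : Submodule ℚ (ℕ → H) := Submodule.span ℚ {g | ∃ A B : H, g = fun s => A * Hx ^ s * B}

def Sp : Submodule ℚ (ℕ → H) := Submodule.span ℚ {g | ∃ A B : H, g = fun s => Hy * A * Hx ^ s * B}

theorem Sp_le_S0 {g : ℕ → H} (h : g ∈ Sp) : g ∈ S0 := by
  refine Submodule.span_mono ?_ h
  rintro g ⟨A, B, rfl⟩
  exact ⟨Hy * A, B, rfl⟩

theorem S0_y {g : ℕ → H} (h : g ∈ S0) : (fun s => Hy * g s) ∈ Sp := by
  induction h using Submodule.span_induction with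
  | mem g hg =>
    obtain ⟨A, B, rfl⟩ := hg
    exact Submodule.subset_span ⟨A, B, by funext s; simp only [mul_assoc]⟩
  | zero =>
    have : (fun s => Hy * (0 : ℕ → H) s) = 0 := by funext s; simp
    rw [this]; exact zero_mem _
  | add a b _ _ ha hb =>
    have : (fun s => Hy * (a + b) s) = (fun s => Hy * a s) + (fun s => Hy * b s) := by
      funext s; simp [mul_add]
    rw [this]; exact add_mem ha hb
  | smul r a _ ha =>
    have : (fun s => Hy * (r • a) s) = r • (fun s => Hy * a s) := by
      funext s; simp
    rw [this]; exact Submodule.smul_mem _ _ ha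

theorem S0_x {g : ℕ → H} (h : g ∈ S0) : (fun s => Hx * g s) ∈ S0 := by
  induction h using Submodule.span_induction with
  | mem g hg =>
    obtain ⟨A, B, rfl⟩ := hg
    exact Submodule.subset_span ⟨Hx * A, B, by funext s; simp only [mul_assoc]⟩
  | zero =>
    have : (fun s => Hx * (0 : ℕ → H) s) = 0 := by funext s; simp
    rw [this]; exact zero_mem _
  | add a b _ _ ha hb =>
    have : (fun s => Hx * (a + b) s) = (fun s => Hx * a s) + (fun s => Hx * b s) := by
      funext s; simp [mul_add]
    rw [this]; exact add_mem ha hb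
  | smul r a _ ha =>
    have : (fun s => Hx * (r • a) s) = r • (fun s => Hx * a s) := by
      funext s; simp
    rw [this]; exact Submodule.smul_mem _ _ ha

theorem st_Sp (hst : IsHarmonic st) (p q : H) (h : (fun s => st (Hy * (Hx ^ s * p)) q) ∈ S0) :
    (fun s => st (Hy * (Hx ^ s * p)) (Hy * q)) ∈ Sp := by
  have e : (fun s => st (Hy * (Hx ^ s * p)) (Hy * q)) =
      (fun s => Hy * 1 * Hx ^ s * st p (Hy * q)) + (fun s => Hy * st (Hy * (Hx ^ s * p)) q) +
        (fun s => Hy * Hx * Hx ^ s * st p q) := by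
    funext s
    simp only [Pi.add_apply]
    rw [hst.2.2.2.2, st_pow_left hst, st_pow_left hst]
    simp only [mul_add, mul_assoc, one_mul]
  rw [e]
  refine add_mem (add_mem ?_ (S0_y h)) ?_
  · exact Submodule.subset_span ⟨1, st p (Hy * q), rfl⟩
  · exact Submodule.subset_span ⟨Hx, st p q, rfl⟩

theorem st_S0 (hst : IsHarmonic st) (p q : H) : (fun s => st (Hy * (Hx ^ s * p)) q) ∈ S0 := by
  refine Hind_left (C := fun q => (fun s => st (Hy * (Hx ^ s * p)) q) ∈ S0) ?_ ?_ ?_ ?_ ?_ q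
  · refine Submodule.subset_span ⟨Hy, p, ?_⟩
    funext s; rw [hst.1, mul_assoc]
  · intro a b ha hb
    have : (fun s => st (Hy * (Hx ^ s * p)) (a + b)) =
      (fun s => st (Hy * (Hx ^ s * p)) a) + (fun s => st (Hy * (Hx ^ s * p)) b) := by
      funext s; simp
    rw [this]; exact add_mem ha hb
  · intro r a ha
    have : (fun s => st (Hy * (Hx ^ s * p)) (r • a)) = r • (fun s => st (Hy * (Hx ^ s * p)) a) := by
      funext s; simp
    rw [this]; exact Submodule.smul_mem _ _ ha
  · intro a ha
    have := S0_x ha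
    simpa only [hst.2.2.2.1] using this
  · intro a ha
    exact Sp_le_S0 (st_Sp hst p a ha)

theorem phi_sandwich (U B : H) (u : ℕ) :
    phi U * (Hx + Hy) ^ u * (phi B * Hx) = phi (U * Hx ^ u * B) * Hx := by
  rw [map_mul, map_mul, map_pow, phi_x]; simp only [mul_assoc]

theorem A1_sub {Z : H →ₗ[ℚ] ℝ} (hZ : IsZetaMap Z) (hst : IsHarmonic st) (p q : H) :
    ∃ (M : ℕ) (c : Fin M → ℚ) (A B : Fin M → H),
      (∀ i, ∃ p, A i = Hy * p) ∧ (∀ i, ∃ q, B i = q * Hx) ∧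
      (∀ u : ℕ, ∑ i, (c i : ℝ) * Z (A i * (Hx + Hy) ^ u * B i) = 0) ∧
      phi (st (Hy * p) (Hy * q)) * Hx = ∑ i, c i • (A i * B i) := by
  have h := st_Sp hst p q (st_S0 hst p q)
  rw [Sp, Submodule.mem_span_set'] at h
  obtain ⟨M, c, g, hg⟩ := h
  have hg2 := fun i => (g i).2
  choose A B hAB using hg2
  have hs : ∀ s, phi (st (Hy * (Hx ^ s * p)) (Hy * q)) * Hx =
      ∑ i, c i • (phi (Hy * A i) * (Hx + Hy) ^ s * (phi (B i) * Hx)) := by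
    intro s
    have := congrFun hg s
    rw [← this, Finset.sum_apply, map_sum, Finset.sum_mul]
    refine Finset.sum_congr rfl (fun i _ => ?_)
    rw [hAB i, phi_sandwich, Pi.smul_apply, map_smul, smul_mul_assoc]
  refine ⟨M, c, fun i => phi (Hy * A i), fun i => phi (B i) * Hx, ?_, ?_, ?_, ?_⟩
  · intro i; exact InY.phi ⟨A i, rfl⟩
  · intro i; exact ⟨phi (B i), rfl⟩
  · intro u
    have h1 := congrArg Z (hs u)
    rw [Z_phi hZ (st_InY hst ⟨_, rfl⟩ ⟨_, rfl⟩), EE_st_zero hst ⟨_, rfl⟩ ⟨_, rfl⟩, map_sum] at h1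
    simp only [map_smul, Rat.smul_def] at h1
    linarith
  · have := hs 0
    simpa using this

/-! ### Dirichlet series uniqueness -/

theorem lin_tendsto {a b : ℝ} (h : Filter.Tendsto (fun u : ℕ => a + u * b) Filter.atTop (nhds 0)) :
    a = 0 ∧ b = 0 := by
  have h1 := ((Filter.tendsto_add_atTop_iff_nat 1).2 h).sub h
  have e : ∀ u : ℕ, (a + ((u + 1 : ℕ) : ℝ) * b) - (a + u * b) = b := by
    intro u; push_cast; ring
  simp only [e, sub_zero] at h1
  have hb := tendsto_nhds_unique tendsto_const_nhds h1
  subst hb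
  simp only [mul_zero, add_zero] at h
  exact ⟨tendsto_nhds_unique tendsto_const_nhds h, rfl⟩

theorem dirichlet {A B : ℕ → ℝ} (hA : Summable A) (hB : Summable B)
    (h : ∀ u : ℕ, ∑' m : ℕ, (A m + u * B m) / ((m : ℝ) + 1) ^ u = 0) (m : ℕ) : A m = 0 ∧ B m = 0 := by
  induction m using Nat.strong_induction_on with
  | _ m ih =>
    set r : ℝ := ((m : ℝ) + 1) / ((m : ℝ) + 2) with hr
    have hr0 : 0 ≤ r := by positivity
    have hr1 : r < 1 := by rw [hr, div_lt_one (by positivity)]; linarith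
    have bound : ∀ u : ℕ, |A m + u * B m| ≤ (∑' k, |A k|) * r ^ u + (∑' k, |B k|) * (u * r ^ u) := by
      intro u
      set f : ℕ → ℝ := fun k => ((m : ℝ) + 1) ^ u * ((A k + u * B k) / ((k : ℝ) + 1) ^ u) with hf
      have hs : Summable f := by
        apply Summable.mul_left
        have hs1 : Summable (fun k => |A k| + u * |B k|) := hA.abs.add (hB.abs.mul_left _)
        refine Summable.of_norm_bounded hs1 (fun k => ?_)
        rw [Real.norm_eq_abs, abs_div]
        have h1 : 1 ≤ |((k : ℝ) + 1) ^ u| := by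
          rw [abs_of_pos (by positivity)]
          apply one_le_pow₀
          have : (0 : ℝ) ≤ k := by positivity
          linarith
        calc |A k + u * B k| / |((k : ℝ) + 1) ^ u| ≤ |A k + u * B k| := div_le_self (abs_nonneg _) h1
          _ ≤ |A k| + |u * B k| := abs_add_le _ _
          _ = _ := by rw [abs_mul, Nat.abs_cast]
      have h0 : ∑' k, f k = 0 := by rw [hf, tsum_mul_left, h u, mul_zero]
      have h1 := hs.tsum_eq_add_tsum_ite m
      rw [h0] at h1
      have h2 : f m = A m + u * B m := by
        simp only [hf]
        have := n1pos m
        field_simp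
      have h3 : A m + u * B m = - ∑' k, (if k = m then 0 else f k) := by rw [← h2]; linarith
      rw [h3, abs_neg]
      have hs2 : HasSum (fun k => |A k| * r ^ u + |B k| * (u * r ^ u))
          ((∑' k, |A k|) * r ^ u + (∑' k, |B k|) * (u * r ^ u)) :=
        (hA.abs.hasSum.mul_right _).add (hB.abs.hasSum.mul_right _)
      rw [← Real.norm_eq_abs]
      refine tsum_of_norm_bounded hs2 (fun k => ?_)
      rcases lt_trichotomy k m with hk | hk | hk
      · rw [if_neg hk.ne]
        simp only [hf, (ih k hk).1, (ih k hk).2]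
        simp
      · rw [if_pos hk, norm_zero]; positivity
      · rw [if_neg hk.ne', Real.norm_eq_abs]
        have e : f k = (A k + u * B k) * (((m : ℝ) + 1) / ((k : ℝ) + 1)) ^ u := by
          simp only [hf, div_pow]; ring
        have hq : ((m : ℝ) + 1) / ((k : ℝ) + 1) ≤ r := by
          rw [hr]
          apply div_le_div_of_nonneg_left (n1pos m).le (by positivity)
          have : (m : ℝ) + 1 ≤ k := by exact_mod_cast hk
          linarith
        have hq0 : 0 ≤ ((m : ℝ) + 1) / ((k : ℝ) + 1) := by positivity
        rw [e, abs_mul, abs_of_nonneg (pow_nonneg hq0 u)]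
        calc |A k + u * B k| * (((m : ℝ) + 1) / ((k : ℝ) + 1)) ^ u
            ≤ (|A k| + |u * B k|) * r ^ u := by
              apply mul_le_mul (abs_add_le _ _) (pow_le_pow_left₀ hq0 hq u) (pow_nonneg hq0 u)
              positivity
          _ = _ := by rw [abs_mul, Nat.abs_cast]; ring
    apply lin_tendsto
    refine squeeze_zero_norm bound ?_
    have t1 := (tendsto_pow_atTop_nhds_zero_of_lt_one hr0 hr1).const_mul (∑' k, |A k|)
    have t2 := (tendsto_self_mul_const_pow_of_lt_one hr0 hr1).const_mul (∑' k, |B k|)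
    simpa using t1.add t2

/-! ### `A₆ ⊆ A₁` -/

def Ps (st : H →ₗ[ℚ] H →ₗ[ℚ] H) : Submodule ℚ H :=
  Submodule.span ℚ {w | ∃ p q : H, w = st (Hy * p) (Hy * q)}

def Claim (st : H →ₗ[ℚ] H →ₗ[ℚ] H) (B : H) (q P : ℕ → ℝ) : Prop :=
  Ob 0 q ∧ Ob (-1) P ∧
  (∀ U, InY U → EE (U * B) 0 = ∑' m, (coef U (m + 1) * P m - GG U m * q m)) ∧
  (∀ U, InY U → ∃ R, InY R ∧ (∀ m, coef R (m + 1) = coef U (m + 1) * q m) ∧ R - U * B ∈ Ps st)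

theorem Ob_aU (U : H) : Ob (-1) (fun m => coef U (m + 1)) := (Ob_coef U).shift le_rfl

theorem Claim.ob {q P : ℕ → ℝ} (hq : Ob 0 q) (hP : Ob (-1) P) {U : H} (hU : InY U) :
    Ob (-2) (fun m => coef U (m + 1) * P m - GG U m * q m) := by
  have h1 := (Ob_aU U).mul hP
  have h2 := (Ob_GG hU).mul hq
  norm_num at h1 h2
  exact h1.sub h2

theorem Claim_one : Claim st 1 (fun _ => 1) (fun _ => 0) := by
  refine ⟨Ob.const 1, Ob.zero _, ?_, ?_⟩
  · intro U hU
    rw [mul_one, EE_eq_sum hU]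
    simp [tsum_neg]
  · intro U hU
    exact ⟨U, hU, by simp, by simp⟩

theorem Claim.add {B B' : H} {q P q' P' : ℕ → ℝ} (h : Claim st B q P) (h' : Claim st B' q' P') :
    Claim st (B + B') (fun m => q m + q' m) (fun m => P m + P' m) := by
  refine ⟨h.1.add h'.1, h.2.1.add h'.2.1, ?_, ?_⟩
  · intro U hU
    rw [mul_add, EE_add, h.2.2.1 U hU, h'.2.2.1 U hU,
      ← (Claim.ob h.1 h.2.1 hU).summable.tsum_add (Claim.ob h'.1 h'.2.1 hU).summable]
    refine tsum_congr (fun m => ?_)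
    ring
  · intro U hU
    obtain ⟨R, hR, h1, h2⟩ := h.2.2.2 U hU
    obtain ⟨R', hR', h1', h2'⟩ := h'.2.2.2 U hU
    refine ⟨R + R', hR.add hR', ?_, ?_⟩
    · intro m; rw [map_add, Pi.add_apply, h1, h1']; ring
    · rw [mul_add, add_sub_add_comm]; exact add_mem h2 h2'

theorem Claim.smul {B : H} {q P : ℕ → ℝ} (h : Claim st B q P) (r : ℚ) :
    Claim st (r • B) (fun m => r * q m) (fun m => r * P m) := by
  refine ⟨h.1.smul r, h.2.1.smul r, ?_, ?_⟩
  · intro U hU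
    rw [mul_smul_comm, EE_smul, h.2.2.1 U hU, ← tsum_mul_left]
    refine tsum_congr (fun m => ?_)
    ring
  · intro U hU
    obtain ⟨R, hR, h1, h2⟩ := h.2.2.2 U hU
    refine ⟨r • R, hR.smul r, ?_, ?_⟩
    · intro m; rw [map_smul, Pi.smul_apply, h1, Rat.smul_def]; ring
    · rw [mul_smul_comm, ← smul_sub]; exact Submodule.smul_mem _ _ h2

theorem Claim.x {B : H} {q P : ℕ → ℝ} (h : Claim st B q P) :
    Claim st (Hx * B) (fun m => q m / ((m : ℝ) + 1))
      (fun m => P m / ((m : ℝ) + 1) + q m / ((m : ℝ) + 1) ^ 2) := by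
  refine ⟨h.1.div.mono (by norm_num), (h.2.1.div.mono (by norm_num)).add (h.1.div2.mono (by norm_num)),
    ?_, ?_⟩
  · intro U hU
    rw [← mul_assoc, h.2.2.1 _ (hU.mul Hx)]
    refine tsum_congr (fun m => ?_)
    rw [GG_x hU, coef_x_succ]
    ring
  · intro U hU
    obtain ⟨R, hR, h1, h2⟩ := h.2.2.2 _ (hU.mul Hx)
    refine ⟨R, hR, ?_, ?_⟩
    · intro m; rw [h1, coef_x_succ]; ring
    · rw [← mul_assoc]; exact h2

theorem Claim.y (hst : IsHarmonic st) {B : H} {q P : ℕ → ℝ} (h : Claim st B q P) :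
    Claim st (Hy * B) (fun m => - ∑ M ∈ Finset.range (m + 1), q M / ((M : ℝ) + 1))
      (fun m => tail (fun m => P m / ((m : ℝ) + 1) + q m / ((m : ℝ) + 1) ^ 2) (m + 1)) := by
  have hq1 : Ob (-1) (fun m => q m / ((m : ℝ) + 1)) := by
    have := h.1.div; norm_num at this; exact this
  set β : ℕ → ℝ := fun m => P m / ((m : ℝ) + 1) + q m / ((m : ℝ) + 1) ^ 2 with hβ'
  have hβ : Ob (-2) β := (h.2.1.div.mono (by norm_num)).add (h.1.div2.mono (by norm_num))
  refine ⟨hq1.psum.neg, hβ.tail.shift le_rfl, ?_, ?_⟩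
  · intro U hU
    rw [← mul_assoc, h.2.2.1 _ (hU.mul Hy)]
    have f1 := fubini (Ob_aU U) hβ
    have f2 := fubini hq1 (Ob_GG hU)
    have o1 : Ob (-2) (fun m => coef U (m + 1) * tail β (m + 1)) := by
      have := (Ob_aU U).mul (hβ.tail.shift le_rfl)
      norm_num at this
      exact this
    have o2 : Ob (-2) (fun m => coef U (m + 1) * β m) :=
      ((Ob_aU U).mul hβ).mono (by norm_num)
    have o3 : Ob (-2) (fun m => β m * ev U m) := by
      have := hβ.mul (Ob_ev U)
      norm_num at this
      exact this
    have o4 : Ob (-2) (fun m => q m / ((m : ℝ) + 1) * tail (GG U) m) := by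
      have := hq1.mul (Ob_GG hU).tail
      norm_num at this
      exact this
    have o5 : Ob (-2) (fun m => GG U m * ∑ M ∈ Finset.range (m + 1), q M / ((M : ℝ) + 1)) := by
      have := (Ob_GG hU).mul hq1.psum
      norm_num at this
      exact this
    have e1 : ∑' m, coef U (m + 1) * tail β m =
        ∑' m, coef U (m + 1) * β m + ∑' m, coef U (m + 1) * tail β (m + 1) := by
      rw [← o2.summable.tsum_add o1.summable]
      refine tsum_congr (fun m => ?_)
      rw [tail_succ hβ.summable m]; ring
    have e2 : ∑' m, β m * ∑ N ∈ Finset.range (m + 1), coef U (N + 1) =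
        ∑' m, β m * ev U m + ∑' m, coef U (m + 1) * β m := by
      rw [← o3.summable.tsum_add o2.summable]
      refine tsum_congr (fun m => ?_)
      rw [Finset.sum_range_succ, ev_eq hU]; ring
    have e3 : ∑' m, (coef (U * Hy) (m + 1) * P m - GG (U * Hy) m * q m) =
        ∑' m, β m * ev U m + ∑' m, q m / ((m : ℝ) + 1) * tail (GG U) m := by
      rw [← o3.summable.tsum_add o4.summable]
      refine tsum_congr (fun m => ?_)
      rw [coef_y_succ, GG_y (KK.of_InY hU), EE_eq_tail hU]
      simp only [hβ']
      ring
    have e4 : ∑' m, (coef U (m + 1) * tail β (m + 1) -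
          GG U m * - ∑ M ∈ Finset.range (m + 1), q M / ((M : ℝ) + 1)) =
        ∑' m, coef U (m + 1) * tail β (m + 1) +
          ∑' m, GG U m * ∑ M ∈ Finset.range (m + 1), q M / ((M : ℝ) + 1) := by
      rw [← o1.summable.tsum_add o5.summable]
      refine tsum_congr (fun m => ?_)
      ring
    rw [e3, e4]
    linarith
  · intro U hU
    obtain ⟨R, hR, h1, h2⟩ := h.2.2.2 _ (hU.mul Hy)
    obtain ⟨V, hV, h3, -⟩ := h.2.2.2 _ InY.y
    refine ⟨R + -(st U V), hR.add (st_InY hst hU hV).neg, ?_, ?_⟩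
    · intro m
      have hV' : ∀ m, coef V (m + 1) = q m / ((m : ℝ) + 1) := by
        intro m; rw [h3, coef_y]; ring
      rw [map_add, map_neg, Pi.add_apply, Pi.neg_apply, h1, coef_st hst hU hV, coef_y_succ,
        ev_eq hV]
      simp only [hV']
      ring
    · have : R + -(st U V) - U * (Hy * B) = (R - U * Hy * B) - st U V := by
        rw [mul_assoc]; abel
      rw [this]
      refine sub_mem h2 (Submodule.subset_span ?_)
      obtain ⟨p, rfl⟩ := hU
      obtain ⟨q, rfl⟩ := hV
      exact ⟨p, q, rfl⟩

theorem exists_Claim (hst : IsHarmonic st) (B : H) : ∃ q P, Claim st B q P := by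
  refine Hind_left (C := fun B => ∃ q P, Claim st B q P) ?_ ?_ ?_ ?_ ?_ B
  · exact ⟨_, _, Claim_one⟩
  · rintro a b ⟨q, P, h⟩ ⟨q', P', h'⟩; exact ⟨_, _, h.add h'⟩
  · rintro r a ⟨q, P, h⟩; exact ⟨_, _, h.smul r⟩
  · rintro a ⟨q, P, h⟩; exact ⟨_, _, h.x⟩
  · rintro a ⟨q, P, h⟩; exact ⟨_, _, h.y hst⟩

theorem Ob.sum {ι : Type} (s : Finset ι) {σ : ℝ} {f : ι → ℕ → ℝ} (h : ∀ i, Ob σ (f i)) :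
    Ob σ (fun N => ∑ i ∈ s, f i N) := by
  classical
  induction s using Finset.induction_on with
  | empty => simpa using Ob.zero σ
  | insert a s ha ih => simpa [Finset.sum_insert ha] using (h a).add ih

theorem InY.zero : InY 0 := ⟨0, by simp⟩

theorem InY.sum {ι : Type} (s : Finset ι) {f : ι → H} (h : ∀ i, InY (f i)) : InY (∑ i ∈ s, f i) := by
  classical
  induction s using Finset.induction_on with
  | empty => simpa using InY.zero
  | insert a s ha ih => rw [Finset.sum_insert ha]; exact (h a).add ih

theorem A6_core (hinj : ∀ w, InY w → (∀ m, coef w (m + 1) = 0) → w = 0) (hst : IsHarmonic st)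
    {M : ℕ} (c : Fin M → ℚ) (U B : Fin M → H) (hU : ∀ i, InY (U i))
    (h : ∀ u : ℕ, ∑ i, (c i : ℝ) * EE (U i * Hx ^ u * B i) 0 = 0) :
    ∑ i, c i • (U i * B i) ∈ Ps st := by
  choose q P hC using fun i => exists_Claim hst (B i)
  choose R hR hRc hRP using fun i => (hC i).2.2.2 (U i) (hU i)
  set A' : ℕ → ℝ := fun m => ∑ i, (c i : ℝ) * (coef (U i) (m + 1) * P i m - GG (U i) m * q i m) with hA'
  set B' : ℕ → ℝ := fun m => ∑ i, (c i : ℝ) * (coef (U i) (m + 1) * q i m / ((m : ℝ) + 1)) with hB'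
  have oB : ∀ i, Ob (-2) (fun m => coef (U i) (m + 1) * q i m / ((m : ℝ) + 1)) := by
    intro i
    have := ((Ob_aU (U i)).mul (hC i).1).div
    norm_num at this
    exact this
  have sA : Summable A' := (Ob.sum Finset.univ (fun i => (Claim.ob (hC i).1 (hC i).2.1 (hU i)).smul (c i))).summable
  have sB : Summable B' := (Ob.sum Finset.univ (fun i => (oB i).smul (c i))).summable
  have hd : ∀ u : ℕ, ∑' m : ℕ, (A' m + u * B' m) / ((m : ℝ) + 1) ^ u = 0 := by
    intro u
    rw [← h u]
    have e : ∀ i, (c i : ℝ) * EE (U i * Hx ^ u * B i) 0 = ∑' m : ℕ, (c i : ℝ) *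
        (coef (U i * Hx ^ u) (m + 1) * P i m - GG (U i * Hx ^ u) m * q i m) := by
      intro i
      rw [(hC i).2.2.1 _ ((hU i).mul _), tsum_mul_left]
    simp only [e]
    rw [← Summable.tsum_finsetSum]
    · refine tsum_congr (fun m => ?_)
      simp only [hA', hB', Finset.mul_sum, ← Finset.sum_add_distrib, Finset.sum_div]
      refine Finset.sum_congr rfl (fun i _ => ?_)
      rw [coef_mul_pow, GG_pow (hU i), pow_succ]
      have := n1pos m
      field_simp
      ring
    · intro i _
      exact (Claim.ob (hC i).1 (hC i).2.1 ((hU i).mul _)).summable.mul_left _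
  have hz := fun m => (dirichlet sA sB hd m).2
  have hR0 : ∑ i, c i • R i = 0 := by
    apply hinj
    · exact InY.sum _ (fun i => (hR i).smul (c i))
    · intro m
      have := hz m
      simp only [hB'] at this
      rw [map_sum, Finset.sum_apply]
      simp only [map_smul, Pi.smul_apply, hRc, Rat.smul_def]
      simp only [← mul_div_assoc, ← Finset.sum_div] at this
      rcases div_eq_zero_iff.1 this with h | h
      · exact h
      · exact absurd h (n1pos m).ne'
  have : ∑ i, c i • (U i * B i) = - ∑ i, c i • (R i - U i * B i) := by
    simp only [smul_sub, Finset.sum_sub_distrib, hR0]; simp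
  rw [this]
  exact neg_mem (Submodule.sum_mem _ (fun i _ => Submodule.smul_mem _ _ (hRP i)))

theorem phi_Ps {w : H} (h : w ∈ Ps st) :
    phi w * Hx ∈ Submodule.span ℚ {w : H | ∃ p q : H, w = phi (st (Hy * p) (Hy * q)) * Hx} := by
  induction h using Submodule.span_induction with
  | mem w hw =>
    obtain ⟨p, q, rfl⟩ := hw
    exact Submodule.subset_span ⟨p, q, rfl⟩
  | zero => simp
  | add a b _ _ ha hb => rw [map_add, add_mul]; exact add_mem ha hb
  | smul r a _ ha => rw [map_smul, smul_mul_assoc]; exact Submodule.smul_mem _ _ ha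

theorem A6_sub (hinj : ∀ w, InY w → (∀ m, coef w (m + 1) = 0) → w = 0)
    {Z : H →ₗ[ℚ] ℝ} (hZ : IsZetaMap Z) (hst : IsHarmonic st)
    {M : ℕ} (c : Fin M → ℚ) (A B : Fin M → H)
    (hA : ∀ i, ∃ p, A i = Hy * p) (hB : ∀ i, ∃ q, B i = q * Hx)
    (h : ∀ u : ℕ, ∑ i, (c i : ℝ) * Z (A i * (Hx + Hy) ^ u * B i) = 0) :
    ∑ i, c i • (A i * B i) ∈
      Submodule.span ℚ {w : H | ∃ p q : H, w = phi (st (Hy * p) (Hy * q)) * Hx} := by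
  choose b hb using hB
  have e : ∀ i u, A i * (Hx + Hy) ^ u * B i = phi (phi (A i) * Hx ^ u * phi (b i)) * Hx := by
    intro i u
    rw [← phi_sandwich, phi_phi, phi_phi, hb i]
  have hU : ∀ i, InY (phi (A i)) := fun i => InY.phi (hA i)
  have h1 := A6_core hinj hst c (fun i => phi (A i)) (fun i => phi (b i)) hU ?_
  · have h2 := phi_Ps h1
    rw [map_sum, Finset.sum_mul] at h2
    refine Set.mem_of_eq_of_mem (Finset.sum_congr rfl (fun i _ => ?_)) h2
    have := e i 0
    simp only [pow_zero, mul_one] at this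
    rw [this, map_smul, smul_mul_assoc]
  · intro u
    have := h u
    simp only [e] at this
    rw [← neg_eq_zero, ← this, ← Finset.sum_neg_distrib]
    refine Finset.sum_congr rfl (fun i _ => ?_)
    rw [Z_phi hZ (((hU i).mul _).mul _)]; ring

end

/-! ### Linear independence of multiple polylogarithms -/

theorem poly_local {p q h k : Polynomial ℝ} {a : ℝ} (hq : q ≠ 0) (hh : h.eval a ≠ 0)
    (H : (Polynomial.X - Polynomial.C a) *
      (Polynomial.derivative p * q - Polynomial.derivative q * p) * h + q ^ 2 * k = 0) :
    k.eval a = 0 := by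
  by_cases hp : p = 0
  · subst hp
    simp [hq] at H
    simp [H]
  obtain ⟨P, hP, hPa⟩ := Polynomial.exists_eq_pow_rootMultiplicity_mul_and_not_dvd p hp a
  obtain ⟨Q, hQ, hQa⟩ := Polynomial.exists_eq_pow_rootMultiplicity_mul_and_not_dvd q hq a
  rw [Polynomial.dvd_iff_isRoot, Polynomial.IsRoot.def] at hPa hQa
  generalize p.rootMultiplicity a = m at hP
  generalize q.rootMultiplicity a = n at hQ
  set u : Polynomial ℝ := Polynomial.X - Polynomial.C a with hu
  have hu0 : u ≠ 0 := Polynomial.X_sub_C_ne_zero a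
  have hua : u.eval a = 0 := by simp [hu]
  have hdu : ∀ j : ℕ, u * Polynomial.derivative (u ^ j) = (j : Polynomial ℝ) * u ^ j := by
    intro j
    cases j with
    | zero => simp
    | succ j =>
      rw [Polynomial.derivative_pow]
      simp [hu]
      ring
  have hp' : u * Polynomial.derivative p
      = u ^ m * ((m : Polynomial ℝ) * P + u * Polynomial.derivative P) := by
    rw [hP, Polynomial.derivative_mul]
    linear_combination P * hdu m
  have hq' : u * Polynomial.derivative q
      = u ^ n * ((n : Polynomial ℝ) * Q + u * Polynomial.derivative Q) := by
    rw [hQ, Polynomial.derivative_mul]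
    linear_combination Q * hdu n
  have key : u ^ (m + n) * ((((m : Polynomial ℝ) - n) * P * Q
      + u * (Polynomial.derivative P * Q - Polynomial.derivative Q * P)) * h)
      + u ^ (2 * n) * (Q ^ 2 * k) = 0 := by
    have e : (u * Polynomial.derivative p * q - u * Polynomial.derivative q * p) * h
        + q ^ 2 * k = 0 := by linear_combination H
    rw [hp', hq'] at e
    rw [hQ] at e
    nth_rewrite 1 [hP] at e
    linear_combination e
  rcases lt_trichotomy m n with hmn | hmn | hmn
  · obtain ⟨d, rfl⟩ : ∃ d, n = m + d + 1 := ⟨n - m - 1, by omega⟩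
    have e2 : u ^ (m + (m + d + 1)) * (((((m : Polynomial ℝ) - ((m + d + 1 : ℕ) : Polynomial ℝ))
      * P * Q + u * (Polynomial.derivative P * Q - Polynomial.derivative Q * P)) * h)
      + u ^ (d + 1) * (Q ^ 2 * k)) = 0 := by
      linear_combination key
    have e3 := (mul_eq_zero.1 e2).resolve_left (pow_ne_zero _ hu0)
    have e4 := congrArg (Polynomial.eval a) e3
    simp [hua] at e4
    rcases e4 with ((e | e) | e) | e
    · exfalso
      have : (d : ℝ) + 1 > 0 := by positivity
      linarith
    · exact absurd e hPa
    · exact absurd e hQa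
    · exact absurd e hh
  · subst hmn
    have e2 : u ^ (2 * m) * ((
      u * (Polynomial.derivative P * Q - Polynomial.derivative Q * P) * h)
      + (Q ^ 2 * k)) = 0 := by
      linear_combination key
    have e3 := (mul_eq_zero.1 e2).resolve_left (pow_ne_zero _ hu0)
    have e4 := congrArg (Polynomial.eval a) e3
    simp [hua, hQa] at e4
    exact e4
  · obtain ⟨d, rfl⟩ : ∃ d, m = n + d + 1 := ⟨m - n - 1, by omega⟩
    have e2 : u ^ (2 * n) * (u ^ (d + 1) * ((((((n + d + 1 : ℕ) : Polynomial ℝ) - n)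
      * P * Q + u * (Polynomial.derivative P * Q - Polynomial.derivative Q * P)) * h))
      + (Q ^ 2 * k)) = 0 := by
      linear_combination key
    have e3 := (mul_eq_zero.1 e2).resolve_left (pow_ne_zero _ hu0)
    have e4 := congrArg (Polynomial.eval a) e3
    simp [hua, hQa] at e4
    exact e4

theorem poly_wronsk {p q : Polynomial ℝ} (hq : q ≠ 0)
    (H : Polynomial.derivative p * q - Polynomial.derivative q * p = 0) :
    ∃ α : ℝ, p = Polynomial.C α * q := by
  have hc := isCoprime_div_gcd_div_gcd (p := p) (q := q) hq
  have hg0 : GCDMonoid.gcd p q ≠ 0 := fun h => hq ((gcd_eq_zero_iff p q).1 h).2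
  have hp1 : GCDMonoid.gcd p q * (p / GCDMonoid.gcd p q) = p :=
    EuclideanDomain.mul_div_cancel' hg0 (GCDMonoid.gcd_dvd_left p q)
  have hq1 : GCDMonoid.gcd p q * (q / GCDMonoid.gcd p q) = q :=
    EuclideanDomain.mul_div_cancel' hg0 (GCDMonoid.gcd_dvd_right p q)
  generalize GCDMonoid.gcd p q = g at *
  generalize p / g = P at *
  generalize q / g = Q at *
  subst hp1
  subst hq1
  have hw : Polynomial.wronskian P Q = 0 := by
    rw [Polynomial.derivative_mul, Polynomial.derivative_mul] at H
    have : g ^ 2 * Polynomial.wronskian P Q = 0 := by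
      rw [Polynomial.wronskian]
      linear_combination -H
    exact (mul_eq_zero.1 this).resolve_left (pow_ne_zero _ hg0)
  obtain ⟨h1, h2⟩ := hc.wronskian_eq_zero_iff.1 hw
  have h1' := Polynomial.eq_C_of_derivative_eq_zero h1
  have h2' := Polynomial.eq_C_of_derivative_eq_zero h2
  have hb : Q.coeff 0 ≠ 0 := by
    intro h
    rw [h] at h2'
    apply hq
    rw [h2']
    simp
  refine ⟨P.coeff 0 / Q.coeff 0, ?_⟩
  have : P = Polynomial.C (P.coeff 0 / Q.coeff 0) * Q := by
    have e : Polynomial.C (P.coeff 0 / Q.coeff 0) * Polynomial.C (Q.coeff 0)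
        = Polynomial.C (P.coeff 0) := by
      rw [← Polynomial.C_mul, div_mul_cancel₀ _ hb]
    rw [← h2', ← h1'] at e
    exact e.symm
  nth_rewrite 1 [this]
  ring

/-- The monomial attached to a list, read from right to left. -/
def wd : List Bool → H
  | [] => 1
  | b :: l => wd l * (if b then Hy else Hx)

/-- Generating series of the coefficients of a monomial. -/
def gs (l : List Bool) : PowerSeries ℝ := PowerSeries.mk (coef (wd l))

theorem gs_nil : gs [] = 1 := by
  ext n
  simp [gs, wd, coef_one, PowerSeries.coeff_one, Pi.single_apply]

theorem coef_wd_zero (b : Bool) (l : List Bool) : coef (wd (b :: l)) 0 = 0 := by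
  cases b
  · simp [wd, coef_mul_x, opX]
  · simp [wd, coef_mul_y, opY]

theorem gs_false (l : List Bool) (hl : l ≠ []) :
    PowerSeries.X * PowerSeries.derivative ℝ (gs (false :: l)) = gs l := by
  ext n
  cases n with
  | zero =>
    obtain ⟨b, m, rfl⟩ := List.exists_cons_of_ne_nil hl
    simp [gs, coef_wd_zero]
  | succ n =>
    rw [mul_comm, PowerSeries.coeff_succ_mul_X, PowerSeries.coeff_derivative]
    have : (n : ℝ) + 1 ≠ 0 := by positivity
    simp [gs, wd, coef_mul_x, opX]
    field_simp

theorem gs_true (l : List Bool) :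
    (1 - PowerSeries.X) * PowerSeries.derivative ℝ (gs (true :: l)) = gs l := by
  ext n
  rw [sub_mul, one_mul, map_sub, mul_comm]
  cases n with
  | zero =>
    rw [PowerSeries.coeff_zero_mul_X, PowerSeries.coeff_derivative]
    simp [gs, wd, coef_mul_y, opY]
  | succ n =>
    rw [PowerSeries.coeff_succ_mul_X, PowerSeries.coeff_derivative, PowerSeries.coeff_derivative]
    have : (n : ℝ) + 1 ≠ 0 := by positivity
    have : (n : ℝ) + 1 + 1 ≠ 0 := by positivity
    simp only [gs, wd, coef_mul_y, opY, PowerSeries.coeff_mk, if_true, LinearMap.coe_mk,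
      AddHom.coe_mk]
    push_cast
    rw [Finset.sum_range_succ _ (n + 1)]
    field_simp
    ring

/-- `X (1 - X)` times the derivative of `gs`. -/
def hs : List Bool → PowerSeries ℝ
  | [] => 0
  | false :: l => (1 - PowerSeries.X) * gs l
  | true :: l => PowerSeries.X * gs l

theorem gs_deriv (l : List Bool) (hl : l ≠ [false]) :
    PowerSeries.X * (1 - PowerSeries.X) * PowerSeries.derivative ℝ (gs l) = hs l := by
  match l, hl with
  | [], _ => rw [gs_nil, PowerSeries.derivative_one]; simp [hs]
  | false :: l, hl =>
    rw [hs, ← gs_false l (by rintro rfl; exact hl rfl)]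
    ring
  | true :: l, _ =>
    rw [hs]
    rw [mul_assoc, gs_true l]

theorem sum_reindex (S : Finset (List Bool)) (hS : ∀ b l, b :: l ∈ S → l ∈ S)
    (F : List Bool → PowerSeries ℝ) (h0 : F [] = 0) (hF : ∀ l, l ∉ S → F l = 0) :
    ∑ l ∈ S, F l = ∑ l ∈ S, (F (false :: l) + F (true :: l)) := by
  classical
  set T := S.image (fun l => false :: l) ∪ S.image (fun l => true :: l) with hT
  have h1 : ∑ l ∈ S, F l = ∑ l ∈ S ∪ T, F l :=
    Finset.sum_subset Finset.subset_union_left (fun x _ hx => hF x hx)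
  have h2 : ∑ l ∈ T, F l = ∑ l ∈ S ∪ T, F l := by
    refine Finset.sum_subset Finset.subset_union_right (fun x hx hx' => ?_)
    have hxS : x ∈ S := by
      rcases Finset.mem_union.1 hx with h | h
      · exact h
      · exact absurd h hx'
    match x, hxS with
    | [], _ => exact h0
    | false :: l, hxS =>
      exact absurd (Finset.mem_union_left _ (Finset.mem_image.2 ⟨l, hS _ _ hxS, rfl⟩)) hx'
    | true :: l, hxS =>
      exact absurd (Finset.mem_union_right _ (Finset.mem_image.2 ⟨l, hS _ _ hxS, rfl⟩)) hx'
  rw [h1, ← h2, hT, Finset.sum_union, Finset.sum_image, Finset.sum_image, Finset.sum_add_distrib]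
  · intro a _ b _ h; simpa using h
  · intro a _ b _ h; simpa using h
  · rw [Finset.disjoint_left]
    intro a ha hb
    obtain ⟨l, _, rfl⟩ := Finset.mem_image.1 ha
    obtain ⟨m, _, h⟩ := Finset.mem_image.1 hb
    simp at h

theorem gs_indep (n : ℕ) : ∀ (S : Finset (List Bool)), S.card = n →
    (∀ b l, b :: l ∈ S → l ∈ S) → [false] ∉ S →
    ∀ p : List Bool → Polynomial ℝ, (∀ l, l ∉ S → p l = 0) →
    ∑ l ∈ S, (p l : PowerSeries ℝ) * gs l = 0 → ∀ l, p l = 0 := by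
  classical
  induction n with
  | zero =>
    intro S hc _ _ p hp _ l
    rw [Finset.card_eq_zero] at hc
    subst hc
    exact hp l (by simp)
  | succ n ih =>
    intro S hc hS hf p hp hrel
    have hne : S.Nonempty := by rw [← Finset.card_pos]; omega
    obtain ⟨w0, hw0, hmax⟩ := S.exists_max_image List.length hne
    have hS' : ∀ b l, b :: l ∈ S.erase w0 → l ∈ S.erase w0 := by
      intro b l h
      rw [Finset.mem_erase] at h ⊢
      refine ⟨?_, hS _ _ h.2⟩
      rintro rfl
      have := hmax _ h.2
      simp at this
    have hcard : (S.erase w0).card = n := by rw [Finset.card_erase_of_mem hw0]; omega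
    have hf' : [false] ∉ S.erase w0 := fun h => hf (Finset.mem_of_mem_erase h)
    have IH := ih (S.erase w0) hcard hS' hf'
    by_cases hq : p w0 = 0
    · refine IH p ?_ ?_
      · intro l hl
        by_cases h : l = w0
        · rw [h, hq]
        · exact hp l (fun h' => hl (Finset.mem_erase.2 ⟨h, h'⟩))
      · rw [← hrel, ← Finset.add_sum_erase S _ hw0, hq]; simp
    exfalso
    have hlong : ∀ l, w0.length < l.length → p l = 0 := by
      intro l hl
      apply hp
      intro h
      have := hmax l h
      omega
    set q := p w0 with hqdef
    let r : List Bool → Polynomial ℝ := fun l =>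
      Polynomial.X * (1 - Polynomial.X) *
        (Polynomial.derivative (p l) * q - Polynomial.derivative q * p l)
      + q * ((1 - Polynomial.X) * p (false :: l) + Polynomial.X * p (true :: l))
    have hr0 : r w0 = 0 := by
      simp only [r]
      rw [hlong (false :: w0) (by simp), hlong (true :: w0) (by simp), ← hqdef]
      ring
    have hrsupp : ∀ l, l ∉ S → r l = 0 := by
      intro l hl
      simp only [r]
      rw [hp l hl, hp (false :: l) (fun h => hl (hS _ _ h)),
        hp (true :: l) (fun h => hl (hS _ _ h))]
      simp
    have hrrel : ∑ l ∈ S, (r l : PowerSeries ℝ) * gs l = 0 := by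
      have hD : ∑ l ∈ S, (((Polynomial.derivative (p l) : Polynomial ℝ) : PowerSeries ℝ) * gs l
          + (p l : PowerSeries ℝ) * PowerSeries.derivative ℝ (gs l)) = 0 := by
        have := congrArg (PowerSeries.derivative ℝ) hrel
        rw [map_sum, map_zero] at this
        rw [← this]
        refine Finset.sum_congr rfl fun l _ => ?_
        rw [Derivation.leibniz, PowerSeries.derivative_coe]
        simp only [smul_eq_mul]
        ring
      have hR := sum_reindex S hS (fun l => (p l : PowerSeries ℝ) * hs l) (by simp [hs])
        (fun l hl => by simp [hp l hl])
      have hD2 : ∑ l ∈ S, (PowerSeries.X * (1 - PowerSeries.X) *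
          ((Polynomial.derivative (p l) : Polynomial ℝ) : PowerSeries ℝ) * gs l
            + (p l : PowerSeries ℝ) * hs l) = 0 := by
        have := congrArg (fun z => PowerSeries.X * (1 - PowerSeries.X) * z) hD
        simp only [Finset.mul_sum, mul_zero] at this
        rw [← this]
        refine Finset.sum_congr rfl fun l hl => ?_
        rw [← gs_deriv l (by rintro rfl; exact hf hl)]
        ring
      rw [Finset.sum_add_distrib, hR, ← Finset.sum_add_distrib] at hD2
      have e1 := congrArg (fun z => (q : PowerSeries ℝ) * z) hD2
      have e2 := congrArg (fun z => PowerSeries.X * (1 - PowerSeries.X) *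
        ((Polynomial.derivative q : Polynomial ℝ) : PowerSeries ℝ) * z) hrel
      simp only [Finset.mul_sum, mul_zero] at e1 e2
      rw [← sub_zero (0 : PowerSeries ℝ)]
      nth_rewrite 1 [← e1]
      rw [← e2, ← Finset.sum_sub_distrib]
      refine Finset.sum_congr rfl fun l _ => ?_
      simp only [r, hs]
      push_cast
      ring
    have hr : ∀ l, r l = 0 := by
      refine IH r ?_ ?_
      · intro l hl
        by_cases h : l = w0
        · rw [h, hr0]
        · exact hrsupp l (fun h' => hl (Finset.mem_erase.2 ⟨h, h'⟩))
      · rw [← hrrel, ← Finset.add_sum_erase S _ hw0, hr0]; simp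
    cases hw : w0 with
    | nil =>
      have hSs : S = {[]} := by
        apply Finset.eq_singleton_iff_unique_mem.2
        refine ⟨hw ▸ hw0, fun l hl => ?_⟩
        have := hmax l hl
        rw [hw] at this
        simpa using this
      rw [hSs, Finset.sum_singleton, gs_nil, mul_one] at hrel
      apply hq
      rw [hqdef, hw]
      exact_mod_cast hrel
    | cons b l0 =>
      have hX : (Polynomial.X * (1 - Polynomial.X) : Polynomial ℝ) ≠ 0 := by
        intro h
        have := congrArg (Polynomial.eval (2 : ℝ)) h
        norm_num at this
      have hprop : ∀ c : Bool, ∃ α : ℝ, p (c :: l0) = Polynomial.C α * q := by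
        intro c
        apply poly_wronsk hq
        have h := hr (c :: l0)
        simp only [r] at h
        rw [hlong (false :: c :: l0) (by simp [hw]), hlong (true :: c :: l0) (by simp [hw])] at h
        simp only [mul_zero, add_zero] at h
        exact (mul_eq_zero.1 h).resolve_left hX
      obtain ⟨α, hα⟩ := hprop false
      obtain ⟨β, hβ⟩ := hprop true
      have hl0 := hr l0
      simp only [r] at hl0
      rw [hα, hβ] at hl0
      have hα0 : α = 0 := by
        have := poly_local (p := p l0) (q := q) (h := 1 - Polynomial.X)
          (k := (1 - Polynomial.X) * Polynomial.C α + Polynomial.X * Polynomial.C β)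
          (a := 0) hq (by simp) (by rw [Polynomial.C_0]; linear_combination hl0)
        simpa using this
      have hβ0 : β = 0 := by
        have := poly_local (p := p l0) (q := q) (h := - Polynomial.X)
          (k := (1 - Polynomial.X) * Polynomial.C α + Polynomial.X * Polynomial.C β)
          (a := 1) hq (by simp) (by rw [Polynomial.C_1]; linear_combination hl0)
        simpa using this
      apply hq
      rw [hqdef, hw]
      cases b
      · rw [hα, hα0]; simp
      · rw [hβ, hβ0]; simp

theorem InY.mem_span {w : H} (h : InY w) :
    w ∈ Submodule.span ℚ (wd '' {l | ∃ m, l = m ++ [true]}) := by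
  have aux : ∀ (c : Bool) (a : H), a ∈ Submodule.span ℚ (wd '' {l | ∃ m, l = m ++ [true]}) →
      a * (if c then Hy else Hx) ∈ Submodule.span ℚ (wd '' {l | ∃ m, l = m ++ [true]}) := by
    intro c a ha
    induction ha using Submodule.span_induction with
    | mem x hx =>
      obtain ⟨l, ⟨m, rfl⟩, rfl⟩ := hx
      exact Submodule.subset_span ⟨c :: (m ++ [true]), ⟨c :: m, rfl⟩, rfl⟩
    | zero => rw [zero_mul]; exact Submodule.zero_mem _
    | add x y _ _ hx hy => rw [add_mul]; exact Submodule.add_mem _ hx hy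
    | smul r x _ hx => rw [smul_mul_assoc]; exact Submodule.smul_mem _ _ hx
  refine Hind_Y (C := fun w => w ∈ Submodule.span ℚ (wd '' {l | ∃ m, l = m ++ [true]}))
    ?_ ?_ ?_ ?_ ?_ h
  · exact Submodule.subset_span ⟨[true], ⟨[], rfl⟩, by simp [wd]⟩
  · intro a b ha hb; exact Submodule.add_mem _ ha hb
  · intro r a ha; exact Submodule.smul_mem _ _ ha
  · intro a _ ha; simpa using aux false a ha
  · intro a _ ha; simpa using aux true a ha

theorem coef_inj (w : H) (hw : InY w) (h : ∀ m, coef w (m + 1) = 0) : w = 0 := by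
  classical
  obtain ⟨c, hc, hcw⟩ := (Finsupp.mem_span_image_iff_linearCombination ℚ).1 hw.mem_span
  have hcoef : coef w = 0 := by
    funext n
    cases n with
    | zero => exact coef_zero_of_InY hw
    | succ n => exact h n
  set S : Finset (List Bool) := c.support.biUnion (fun l => l.tails.toFinset) with hS
  have hmemS : ∀ l, l ∈ S ↔ ∃ a ∈ c.support, l <:+ a := by
    intro l; simp [hS]
  have hsub : c.support ⊆ S := fun l hl => (hmemS l).2 ⟨l, hl, List.suffix_refl l⟩
  have hsupp : ∀ l ∈ c.support, ∃ m, l = m ++ [true] := by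
    intro l hl
    exact (Finsupp.mem_supported ℚ c).1 hc hl
  have main := gs_indep S.card S rfl ?_ ?_ (fun l => Polynomial.C (c l : ℝ)) ?_ ?_
  · have hc0 : c = 0 := by
      ext l
      have := main l
      simpa using this
    rw [← hcw, hc0, map_zero]
  · intro b l hl
    obtain ⟨a, ha, hla⟩ := (hmemS _).1 hl
    exact (hmemS _).2 ⟨a, ha, (List.suffix_cons b l).trans hla⟩
  · intro hl
    obtain ⟨a, ha, k, hk⟩ := (hmemS _).1 hl
    obtain ⟨m, hm⟩ := hsupp a ha
    rw [hm] at hk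
    have := (List.append_inj' hk rfl).2
    simp at this
  · intro l hl
    have : c l = 0 := by
      by_contra hne
      exact hl (hsub (Finsupp.mem_support_iff.2 hne))
    simp [this]
  · have h2 : coef w = ∑ l ∈ S, c l • coef (wd l) := by
      rw [← hcw, Finsupp.linearCombination_apply, Finsupp.sum, map_sum]
      simp only [map_smul]
      refine Finset.sum_subset hsub fun l _ hl => ?_
      rw [Finsupp.notMem_support_iff.1 hl, zero_smul]
    ext n
    have h3 := congrFun (h2.symm.trans hcoef) n
    simp only [Finset.sum_apply, Pi.smul_apply, Pi.zero_apply, Rat.smul_def] at h3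
    rw [map_sum, map_zero, ← h3]
    refine Finset.sum_congr rfl fun l _ => ?_
    simp [gs]

/-- The `ℚ`-subspaces of `ℌ`
`A₁ = span{φ(u ∗ v)x : u,v ∈ yℌ}`,
`A₅ = span{∑ᵢ n_i A_i (x+y)^s B_i : ∑ᵢ n_i f(A_i,B_i) = 0}`, and
`A₆ = span{∑ᵢ n_i A_i B_i : ∑ᵢ n_i f(A_i,B_i) = 0}` coincide. -/
theorem statement9 (Z : H →ₗ[ℚ] ℝ) (hZ : IsZetaMap Z)
    (st : H →ₗ[ℚ] H →ₗ[ℚ] H) (hst : IsHarmonic st) :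
    Submodule.span ℚ {w : H | ∃ p q : H, w = phi (st (Hy * p) (Hy * q)) * Hx}
        = Submodule.span ℚ {w : H |
            ∃ (M : ℕ) (c : Fin M → ℚ) (A B : Fin M → H) (s : ℕ),
              (∀ i, ∃ p, A i = Hy * p) ∧ (∀ i, ∃ q, B i = q * Hx) ∧
              (∀ u : ℕ, ∑ i, (c i : ℝ) * Z (A i * (Hx + Hy) ^ u * B i) = 0) ∧
              w = ∑ i, c i • (A i * (Hx + Hy) ^ s * B i)} ∧
    Submodule.span ℚ {w : H | ∃ p q : H, w = phi (st (Hy * p) (Hy * q)) * Hx}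
        = Submodule.span ℚ {w : H |
            ∃ (M : ℕ) (c : Fin M → ℚ) (A B : Fin M → H),
              (∀ i, ∃ p, A i = Hy * p) ∧ (∀ i, ∃ q, B i = q * Hx) ∧
              (∀ u : ℕ, ∑ i, (c i : ℝ) * Z (A i * (Hx + Hy) ^ u * B i) = 0) ∧
              w = ∑ i, c i • (A i * B i)} := by

  have h16 : ∀ p q : H, ∃ (M : ℕ) (c : Fin M → ℚ) (A B : Fin M → H),
      (∀ i, ∃ p, A i = Hy * p) ∧ (∀ i, ∃ q, B i = q * Hx) ∧
      (∀ u : ℕ, ∑ i, (c i : ℝ) * Z (A i * (Hx + Hy) ^ u * B i) = 0) ∧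
      phi (st (Hy * p) (Hy * q)) * Hx = ∑ i, c i • (A i * B i) := A1_sub hZ hst
  refine ⟨le_antisymm ?_ ?_, le_antisymm ?_ ?_⟩
  · rw [Submodule.span_le]
    rintro w ⟨p, q, rfl⟩
    obtain ⟨M, c, A, B, hA, hB, h, he⟩ := h16 p q
    refine Submodule.subset_span ⟨M, c, A, B, 0, hA, hB, h, ?_⟩
    rw [he]
    simp only [pow_zero, mul_one]
  · rw [Submodule.span_le]
    rintro w ⟨M, c, A, B, s, hA, hB, h, rfl⟩
    refine A6_sub coef_inj hZ hst c (fun i => A i * (Hx + Hy) ^ s) B ?_ hB ?_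
    · intro i
      exact InY.mul (hA i) _
    · intro u
      rw [← h (s + u)]
      simp only [pow_add, mul_assoc]
  · rw [Submodule.span_le]
    rintro w ⟨p, q, rfl⟩
    exact Submodule.subset_span (h16 p q)
  · rw [Submodule.span_le]
    rintro w ⟨M, c, A, B, hA, hB, h, rfl⟩
    exact A6_sub coef_inj hZ hst c A B hA hB h

end
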